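/- Let C be a contour with site set S such that Assumption 1 holds, and let L be a staircase contour labeling of (C,S) in which every left label has its port on C_L and every right label has its port on C_R. Then L is planar if and only if no two leaders of L intersect and no two consecutive labels of L (with respect to the radial ordering) intersect. -/

import Mathlib

open scoped Classical
noncomputable section

/-- Points of the Euclidean plane. -/
abbrev Pt : Type := ℝ × ℝ

/-- Cross product of `b - a` with `p - a`; its sign gives the orientation of `p`
relative to the directed line from `a` to `b`. -/
def cross2 (a b p : Pt) : ℝ := (b.1 - a.1) * (p.2 - a.2) - (b.2 - a.2) * (p.1 - a.1)

/-- `p` lies strictly to the right of the directed line from `a` to `b`. -/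
def StrictRightOf (a b p : Pt) : Prop := cross2 a b p < 0

/-- `p` lies strictly to the left of the directed line from `a` to `b`. -/
def StrictLeftOf (a b p : Pt) : Prop := 0 < cross2 a b p

/-- `p` lies on or to the left of the directed line from `a` to `b`. -/
def LeftOrOn (a b p : Pt) : Prop := 0 ≤ cross2 a b p

/-- The line through two points `a` and `b`. -/
def lineThrough (a b : Pt) : Set Pt := {p | cross2 a b p = 0}

/-- The half-line emanating from `a` through `b`. -/
def halfLine (a b : Pt) : Set Pt := {p | ∃ t : ℝ, 0 ≤ t ∧ p = a + t • (b - a)}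

/-- A contour: a compact convex subset of the plane with nonempty interior. -/
structure IsContour (C : Set Pt) : Prop where
  compact : IsCompact C
  convex : Convex ℝ C
  nonempty_interior : (interior C).Nonempty

/-- `t` is a topmost point of `C`. -/
def IsTopmost (C : Set Pt) (t : Pt) : Prop := t ∈ C ∧ ∀ q ∈ C, q.2 ≤ t.2

/-- The left chain of `C`: boundary points of minimal `x`-coordinate among the
points of `C` of the same `y`-coordinate. -/
def leftChain (C : Set Pt) : Set Pt :=
  {p | p ∈ C ∧ p ∈ frontier C ∧ ∀ q ∈ C, q.2 = p.2 → p.1 ≤ q.1}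

/-- The right chain of `C`: boundary points of maximal `x`-coordinate among the
points of `C` of the same `y`-coordinate. -/
def rightChain (C : Set Pt) : Set Pt :=
  {p | p ∈ C ∧ p ∈ frontier C ∧ ∀ q ∈ C, q.2 = p.2 → q.1 ≤ p.1}

/-- The sites are in general position: no three of them are collinear. -/
def GenPos (S : Finset Pt) : Prop :=
  ∀ a ∈ S, ∀ b ∈ S, ∀ c ∈ S, a ≠ b → b ≠ c → a ≠ c →
    ¬ Collinear ℝ ({a, b, c} : Set Pt)

/-- A label: a site, an axis-parallel closed rectangular text box (given by its
lower-left corner `lo` and upper-right corner `hi`), a port, and an orientation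
flag `isLeft` (`true` for a left label, `false` for a right label). -/
structure Label where
  site : Pt
  lo : Pt
  hi : Pt
  port : Pt
  isLeft : Bool

/-- The text box of a label, as a point set. -/
def Label.box (ℓ : Label) : Set Pt := Set.Icc ℓ.lo ℓ.hi

/-- The leader of a label: the closed segment from its site to its port. -/
def Label.leader (ℓ : Label) : Set Pt := segment ℝ ℓ.site ℓ.port

/-- A label as a point set: the union of its text box and its leader. -/
def Label.toSet (ℓ : Label) : Set Pt := ℓ.box ∪ ℓ.leader

/-- A valid label with respect to a contour `C`: nondegenerate box whose interior
is disjoint from `C`, port on the boundary of `C` and on the right (resp. left)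
edge of the text box for a left (resp. right) label (criterion T4), and leader
contained in `C`. -/
structure IsLabel (C : Set Pt) (ℓ : Label) : Prop where
  lo_le_hi : ℓ.lo ≤ ℓ.hi
  box_out : interior ℓ.box ∩ C = ∅
  port_bd : ℓ.port ∈ frontier C
  leader_in : ℓ.leader ⊆ C
  left_ok : ℓ.isLeft = true → ℓ.port.1 = ℓ.hi.1 ∧ ℓ.port.2 ∈ Set.Icc ℓ.lo.2 ℓ.hi.2
  right_ok : ℓ.isLeft = false → ℓ.port.1 = ℓ.lo.1 ∧ ℓ.port.2 ∈ Set.Icc ℓ.lo.2 ℓ.hi.2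

/-- The baseline of a label: the horizontal half-line emanating from the
bottom/top outer corner of the text box, away from the figure; a label is a top
label if the `y`-coordinate of its port is at least that of its site. -/
def Label.baseline (ℓ : Label) : Set Pt :=
  if ℓ.isLeft then
    (if ℓ.site.2 ≤ ℓ.port.2 then {p : Pt | p.2 = ℓ.hi.2 ∧ p.1 ≤ ℓ.lo.1}
     else {p : Pt | p.2 = ℓ.lo.2 ∧ p.1 ≤ ℓ.lo.1})
  else
    (if ℓ.site.2 ≤ ℓ.port.2 then {p : Pt | p.2 = ℓ.hi.2 ∧ ℓ.hi.1 ≤ p.1}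
     else {p : Pt | p.2 = ℓ.lo.2 ∧ ℓ.hi.1 ≤ p.1})

/-- Every left label has its port on the left chain and every right label has
its port on the right chain. -/
def PortsOnChains (C : Set Pt) (L : List Label) : Prop :=
  ∀ ℓ ∈ L, (ℓ.isLeft = true → ℓ.port ∈ leftChain C) ∧
           (ℓ.isLeft = false → ℓ.port ∈ rightChain C)

/-- `ChainPortOK C ℓ`: the port of `ℓ` lies on the chain matching its side. -/
def ChainPortOK (C : Set Pt) (ℓ : Label) : Prop :=
  (ℓ.isLeft = true → ℓ.port ∈ leftChain C) ∧ (ℓ.isLeft = false → ℓ.port ∈ rightChain C)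

/-- Clockwise order (from the topmost point) of two boundary points of `C` that
lie on its chains: the right chain is traversed top-down before the left chain
is traversed bottom-up. -/
def CwLT (C : Set Pt) (p q : Pt) : Prop :=
  (p ∈ rightChain C ∧ q ∈ rightChain C ∧ q.2 < p.2) ∨
  (p ∈ rightChain C ∧ q ∈ leftChain C ∧ q ∉ rightChain C) ∨
  (p ∉ rightChain C ∧ p ∈ leftChain C ∧ q ∈ leftChain C ∧ q ∉ rightChain C ∧ p.2 < q.2)

/-- A list of labels is in radial order if consecutive list entries have ports in
clockwise order along the boundary of `C`. -/
def InRadialOrder (C : Set Pt) (L : List Label) : Prop :=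
  L.Chain' (fun a b => CwLT C a.port b.port)

/-- A contour labeling of `(C, S)`, represented as the list of its labels in
radial order: exactly one valid label for each site of `S`. -/
structure IsContourLabeling (C : Set Pt) (S : Finset Pt) (L : List Label) : Prop where
  valid : ∀ ℓ ∈ L, IsLabel C ℓ
  nodup_sites : (L.map Label.site).Nodup
  sites_iff : ∀ s : Pt, s ∈ S ↔ s ∈ L.map Label.site
  radial : InRadialOrder C L

/-- A labeling is planar if its labels are pairwise disjoint point sets. -/
def PlanarList (L : List Label) : Prop :=
  L.Pairwise (fun a b => a.toSet ∩ b.toSet = ∅)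

/-- Two labels are consecutive in the cyclic radial ordering. -/
def Consecutive (L : List Label) (a b : Label) : Prop :=
  (a, b) ∈ L.zip (L.rotate 1) ∨ (b, a) ∈ L.zip (L.rotate 1)

/-- Staircase property (criterion T5): no label intersects the baseline of a
consecutive label. -/
def IsStaircase (L : List Label) : Prop :=
  ∀ a b, Consecutive L a b → a.toSet ∩ b.baseline = ∅ ∧ b.toSet ∩ a.baseline = ∅

/-- Assumption 1: no text box of any label intersects the convex hull of the sites. -/
def Assumption1 (S : Finset Pt) (L : List Label) : Prop :=
  ∀ ℓ ∈ L, ℓ.box ∩ convexHull ℝ (S : Set Pt) = ∅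

/-- No two leaders of the labeling intersect. -/
def LeadersDisjoint (L : List Label) : Prop :=
  L.Pairwise (fun a b => a.leader ∩ b.leader = ∅)

/-- No two consecutive labels of the labeling intersect. -/
def ConsecutiveDisjoint (L : List Label) : Prop :=
  ∀ a b, Consecutive L a b → a ≠ b → a.toSet ∩ b.toSet = ∅

/-- The (open) path cost of a list of labels:
`Σ c1(ℓ_i) + Σ c2(ℓ_i, ℓ_{i+1})` over consecutive pairs of the list. -/
def pathCost (c1 : Label → ℝ) (c2 : Label → Label → ℝ) (L : List Label) : ℝ :=
  (L.map c1).sum + (List.zipWith c2 L L.tail).sum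

/-- The cyclic cost of a labeling:
`Σ_{i=1}^n ( c1(ℓ_i) + c2(ℓ_i, ℓ_{i+1}) )` with `ℓ_{n+1} = ℓ_1`. -/
def cycCost (c1 : Label → ℝ) (c2 : Label → Label → ℝ) (L : List Label) : ℝ :=
  (L.map c1).sum + (List.zipWith c2 L (L.rotate 1)).sum

/-- The polyline through a list of points, as a point set. -/
def polyline : List Pt → Set Pt
  | [] => ∅
  | [a] => {a}
  | a :: b :: r => segment ℝ a b ∪ polyline (b :: r)

/-- A convex chain `(s_1, …, s_k)`: at least two pairwise distinct points that
appear in this order on the boundary of their convex hull (the hull lies to the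
left of each directed edge), the interior points lying strictly to the right of
the directed line from `s_1` to `s_k`. -/
def IsConvexChain (K : List Pt) : Prop :=
  2 ≤ K.length ∧ K.Nodup ∧
  (∀ ab ∈ K.zip K.tail, ∀ p ∈ K, LeftOrOn ab.1 ab.2 p) ∧
  (∀ p ∈ K, LeftOrOn K.getLast! K.head! p) ∧
  (∀ s ∈ (K.drop 1).dropLast, StrictRightOf K.head! K.getLast! s)

/-- A (candidate) sub-instance, given by its separator: the two fixed labels
`la` and `lb` and the convex chain `K` from the site of `la` to the site of `lb`. -/
structure SubInstance where
  la : Label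
  lb : Label
  K : List Pt

namespace SubInstance

/-- The separator `K' = (p_1, s_1, …, s_k, p_k)` as a point set. -/
def sepSet (J : SubInstance) : Set Pt :=
  J.la.leader ∪ polyline J.K ∪ J.lb.leader

/-- The interior sites `s_2, …, s_{k-1}` of the chain of the separator. -/
def innerSites (J : SubInstance) : Set Pt := {p | p ∈ (J.K.drop 1).dropLast}

/-- The region `C'` of the sub-instance: the part of `C` cut off by the
separator that does not contain the topmost point `t`. -/
def region (C : Set Pt) (t : Pt) (J : SubInstance) : Set Pt :=
  C \ connectedComponentIn (C \ J.sepSet) t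

/-- The region `C''`: the closed part of `C` on the side of the separator that
contains the topmost point `t` (the concave counterpart). -/
def regionTop (C : Set Pt) (t : Pt) (J : SubInstance) : Set Pt :=
  C ∩ closure (connectedComponentIn (C \ J.sepSet) t)

/-- The sites belonging to the sub-instance: the sites of `S` in its region,
other than the sites of the two separator labels. -/
def sites (C : Set Pt) (t : Pt) (S : Finset Pt) (J : SubInstance) : Set Pt :=
  {s | s ∈ (S : Set Pt) ∧ s ∈ J.region C t ∧ s ≠ J.la.site ∧ s ≠ J.lb.site}

/-- Region `A_1` of the concave part `C''`: the part of `C''` strictly to the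
left of the line from `s_1` to `s_k` that is adjacent to the leader of `la`. -/
def A1 (C : Set Pt) (t : Pt) (J : SubInstance) : Set Pt :=
  {p | p ∈ J.regionTop C t ∧ StrictLeftOf J.la.site J.lb.site p ∧
    (closure (connectedComponentIn
        (J.regionTop C t ∩ {q | StrictLeftOf J.la.site J.lb.site q}) p)
      ∩ J.la.leader).Nonempty}

/-- Region `A_3` of the concave part `C''`: the part of `C''` strictly to the
left of the line from `s_1` to `s_k` that is adjacent to the leader of `lb`. -/
def A3 (C : Set Pt) (t : Pt) (J : SubInstance) : Set Pt :=
  {p | p ∈ J.regionTop C t ∧ StrictLeftOf J.la.site J.lb.site p ∧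
    (closure (connectedComponentIn
        (J.regionTop C t ∩ {q | StrictLeftOf J.la.site J.lb.site q}) p)
      ∩ J.lb.leader).Nonempty}

/-- Region `A_2` of the concave part `C''`: the part strictly to the right of
the line from `s_1` to `s_k`. -/
def A2 (C : Set Pt) (t : Pt) (J : SubInstance) : Set Pt :=
  {p | p ∈ J.regionTop C t ∧ StrictRightOf J.la.site J.lb.site p}

/-- For a capstone instance: the part `A_1` of the region of the instance
strictly to the right of the line from `s_1` to `s_2`, adjacent to the leader
of `la`. -/
def A1cap (C : Set Pt) (t : Pt) (J : SubInstance) : Set Pt :=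
  {p | p ∈ J.region C t ∧ StrictRightOf J.la.site J.lb.site p ∧
    (closure (connectedComponentIn
        (J.region C t ∩ {q | StrictRightOf J.la.site J.lb.site q}) p)
      ∩ J.la.leader).Nonempty}

/-- For a capstone instance: the part `A_3` of the region of the instance
strictly to the right of the line from `s_1` to `s_2`, adjacent to the leader
of `lb`. -/
def A3cap (C : Set Pt) (t : Pt) (J : SubInstance) : Set Pt :=
  {p | p ∈ J.region C t ∧ StrictRightOf J.la.site J.lb.site p ∧
    (closure (connectedComponentIn
        (J.region C t ∩ {q | StrictRightOf J.la.site J.lb.site q}) p)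
      ∩ J.lb.leader).Nonempty}

/-- For a capstone instance: the part `A_2` of the region of the instance
strictly to the left of the line from `s_1` to `s_2`. -/
def A2cap (C : Set Pt) (t : Pt) (J : SubInstance) : Set Pt :=
  {p | p ∈ J.region C t ∧ StrictLeftOf J.la.site J.lb.site p}

end SubInstance

/-- Well-formedness of a separator: the two labels are valid, satisfy T4 with
ports on the correct chains, are disjoint, the chain is convex and runs from the
site of `la` to the site of `lb`, and the port of `la` is met before the port
of `lb` when traversing the boundary clockwise from the topmost point. -/
structure IsSeparator (C : Set Pt) (t : Pt) (J : SubInstance) : Prop where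
  la_valid : IsLabel C J.la
  lb_valid : IsLabel C J.lb
  la_chain : ChainPortOK C J.la
  lb_chain : ChainPortOK C J.lb
  disj : J.la.toSet ∩ J.lb.toSet = ∅
  chain : IsConvexChain J.K
  head_eq : J.K.head? = some J.la.site
  last_eq : J.K.getLast? = some J.lb.site
  order : CwLT C J.la.port J.lb.port

/-- A label is contained in a sub-instance if its leader lies in the region of
the sub-instance and meets the separator at most in the interior chain sites,
and its port lies on the part of the boundary of `C` belonging to the
sub-instance. -/
def ContainedIn (C : Set Pt) (t : Pt) (J : SubInstance) (ℓ : Label) : Prop :=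
  ℓ.leader ⊆ J.region C t ∧
  ℓ.leader ∩ J.sepSet ⊆ J.innerSites ∧
  ℓ.port ∈ frontier C ∧ ℓ.port ∈ J.region C t

/-- The restriction `L|J` of a radially ordered labeling `L` to a sub-instance
`J`: the labels of `L` contained in `J`, together with the two separator labels
of `J`, in radial order. -/
def restrict (C : Set Pt) (t : Pt) (L : List Label) (J : SubInstance) : List Label :=
  J.la :: (L.filter (fun ℓ => decide (ContainedIn C t J ℓ)) ++ [J.lb])

/-- A planar labeling of a convex instance `J`: the two fixed separator labels
(first and last in radial order) together with exactly one label for each site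
of the instance, pairwise disjoint, each contained in the instance. -/
structure IsInstanceLabeling (C : Set Pt) (t : Pt) (S : Finset Pt)
    (J : SubInstance) (L : List Label) : Prop where
  sep : IsSeparator C t J
  head_eq : L.head? = some J.la
  last_eq : L.getLast? = some J.lb
  valid : ∀ ℓ ∈ L, IsLabel C ℓ
  contained : ∀ ℓ ∈ L, ℓ ≠ J.la → ℓ ≠ J.lb → ContainedIn C t J ℓ
  nodup_sites : (L.map Label.site).Nodup
  sites_iff : ∀ s : Pt, s ∈ J.sites C t S ↔ ∃ ℓ ∈ L, ℓ ≠ J.la ∧ ℓ ≠ J.lb ∧ ℓ.site = s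
  planar : PlanarList L
  radial : InRadialOrder C L

/-- `W` separates `A` from `B` inside the ambient set `amb`: no connected subset
of `amb \ W` meets both `A` and `B`. -/
def SeparatesIn (amb W A B : Set Pt) : Prop :=
  ∀ a ∈ A \ W, ∀ b ∈ B \ W, b ∉ connectedComponentIn (amb \ W) a

/-- The convex instance `J` has type A with support point `s`: `s` is a site in
region `A_1` such that the label `la` together with the half-line emanating from
`s` through the site of `la` separates the chain `K` from the sites in the
concave part `C''`. -/
def IsTypeA (C : Set Pt) (t : Pt) (S : Finset Pt) (J : SubInstance) (s : Pt) : Prop :=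
  s ∈ (S : Set Pt) ∧ s ∈ J.A1 C t ∧
  SeparatesIn C (J.la.toSet ∪ halfLine s J.la.site)
    {p | p ∈ J.K} ((S : Set Pt) ∩ J.regionTop C t)

/-- The convex instance `J` has type B with support point `s`: `s` is a site in
region `A_3` such that the label `lb` together with the half-line emanating from
`s` through the site of `lb` separates the chain `K` from the sites in the
concave part `C''`. -/
def IsTypeB (C : Set Pt) (t : Pt) (S : Finset Pt) (J : SubInstance) (s : Pt) : Prop :=
  s ∈ (S : Set Pt) ∧ s ∈ J.A3 C t ∧
  SeparatesIn C (J.lb.toSet ∪ halfLine s J.lb.site)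
    {p | p ∈ J.K} ((S : Set Pt) ∩ J.regionTop C t)

/-- The concave part `C''` of the instance contains no sites (besides the chain
sites themselves); this is the case of support point `⊥`. -/
def ConcaveEmpty (C : Set Pt) (t : Pt) (S : Finset Pt) (J : SubInstance) : Prop :=
  (S : Set Pt) ∩ J.regionTop C t ⊆ {p | p ∈ J.K}

/-- A capstone instance: the chain consists only of the two separator sites. -/
def IsCapstone (J : SubInstance) : Prop :=
  J.K = [J.la.site, J.lb.site]

/-- Two sub-instances are disjoint if the interiors of their regions are disjoint. -/
def InstancesDisjoint (C : Set Pt) (t : Pt) (J J' : SubInstance) : Prop :=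
  interior (J.region C t) ∩ interior (J'.region C t) = ∅

end


/-- Coordinate model of a labeling. -/
structure CM (ι : Type) where
  C : ℝ → ℝ → Prop
  sx : ι → ℝ
  sy : ι → ℝ
  px : ι → ℝ
  py : ι → ℝ
  x0 : ι → ℝ
  x1 : ι → ℝ
  y0 : ι → ℝ
  y1 : ι → ℝ
  left : ι → Prop
  top : ι → Prop
  Adj : ι → ι → Prop

namespace CM

variable {ι : Type}

def Box (M : CM ι) (i : ι) (x y : ℝ) : Prop :=
  M.x0 i ≤ x ∧ x ≤ M.x1 i ∧ M.y0 i ≤ y ∧ y ≤ M.y1 i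

def Lead (M : CM ι) (i : ι) (x y : ℝ) : Prop :=
  ∃ t : ℝ, 0 ≤ t ∧ t ≤ 1 ∧ x = M.px i + t * (M.sx i - M.px i) ∧ y = M.py i + t * (M.sy i - M.py i)

def Base (M : CM ι) (i : ι) (x y : ℝ) : Prop :=
  (M.left i → x ≤ M.x0 i) ∧ (¬ M.left i → M.x1 i ≤ x) ∧
  (M.top i → y = M.y1 i) ∧ (¬ M.top i → y = M.y0 i)

def Ahead (M : CM ι) (i : ι) (x : ℝ) : Prop :=
  (M.left i → x < M.px i) ∧ (¬ M.left i → M.px i < x)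

def BadUp (M : CM ι) (i : ι) : Prop :=
  ∃ x y, M.C x y ∧ M.Ahead i x ∧ M.py i < y ∧ y ≤ M.y1 i

def BadDown (M : CM ι) (i : ι) : Prop :=
  ∃ x y, M.C x y ∧ M.Ahead i x ∧ y < M.py i ∧ M.y0 i ≤ y

noncomputable def t1 (M : CM ι) (i : ι) : ℝ := if M.BadUp i then M.py i else M.y1 i

noncomputable def t0 (M : CM ι) (i : ι) : ℝ := if M.BadDown i then M.py i else M.y0 i

structure OK (M : CM ι) : Prop where
  conv : ∀ x y x' y' t : ℝ, M.C x y → M.C x' y' → 0 ≤ t → t ≤ 1 →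
    M.C (x + t * (x' - x)) (y + t * (y' - y))
  Cs : ∀ i, M.C (M.sx i) (M.sy i)
  Cp : ∀ i, M.C (M.px i) (M.py i)
  star : ∀ i j x y t, M.C x y → 0 ≤ t → t < 1 →
    M.px j = M.sx i + t * (x - M.sx i) → M.py j = M.sy i + t * (y - M.sy i) → False
  chR : ∀ i x, ¬ M.left i → M.C x (M.py i) → x ≤ M.px i
  chL : ∀ i x, M.left i → M.C x (M.py i) → M.px i ≤ x
  bx : ∀ i, M.x0 i ≤ M.x1 i
  byl : ∀ i, M.y0 i ≤ M.py i
  byh : ∀ i, M.py i ≤ M.y1 i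
  pR : ∀ i, ¬ M.left i → M.px i = M.x0 i
  pL : ∀ i, M.left i → M.px i = M.x1 i
  bout : ∀ i x y, M.C x y → M.x0 i < x → x < M.x1 i → M.y0 i < y → y < M.y1 i → False
  hull : ∀ i j k t, 0 ≤ t → t ≤ 1 →
    M.Box k (M.sx i + t * (M.sx j - M.sx i)) (M.sy i + t * (M.sy j - M.sy i)) → False
  top1 : ∀ i, M.top i → M.sy i ≤ M.py i
  top2 : ∀ i, ¬ M.top i → M.py i ≤ M.sy i
  ld : ∀ i j x y, i ≠ j → M.Lead i x y → M.Lead j x y → False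
  ad : ∀ i j x y, M.Adj i j → i ≠ j → M.Box i x y → M.Box j x y → False
  adl : ∀ i j x y, M.Adj i j → i ≠ j → M.Box i x y → M.Lead j x y → False
  base : ∀ i j x y, M.Adj i j → i ≠ j → (M.Box j x y ∨ M.Lead j x y) → M.Base i x y → False
  sym : ∀ i j, M.Adj i j → M.Adj j i
  o1 : ∀ u v, (M.left u ↔ M.left v) → M.py v < M.py u →
    (∀ w, (M.left w ↔ M.left u) → M.py v < M.py w → M.py w < M.py u → False) → M.Adj u v
  o4l : ∀ b u, ¬ M.left b → M.left u → (∀ w, ¬ M.left w → M.py b ≤ M.py w) →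
    (∀ w, M.left w → M.py u ≤ M.py w) → M.Adj b u
  o4h : ∀ b u, ¬ M.left b → M.left u → (∀ w, ¬ M.left w → M.py w ≤ M.py b) →
    (∀ w, M.left w → M.py w ≤ M.py u) → M.Adj b u
  o5 : ∀ b c k, b ≠ c → ¬ M.Adj b c →
    (M.px b - M.sx k) * (M.py c - M.sy k) - (M.py b - M.sy k) * (M.px c - M.sx k) ≠ 0 →
    ∃ u α β, M.Adj b u ∧ u ≠ b ∧ u ≠ c ∧ 0 < α ∧ 0 < β ∧
      M.px u = M.sx k + α * (M.px b - M.sx k) + β * (M.px c - M.sx k) ∧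
      M.py u = M.sy k + α * (M.py b - M.sy k) + β * (M.py c - M.sy k)

/-- Reflection in the vertical axis. -/
def rx (M : CM ι) : CM ι where
  C x y := M.C (-x) y
  sx i := - M.sx i
  sy := M.sy
  px i := - M.px i
  py := M.py
  x0 i := - M.x1 i
  x1 i := - M.x0 i
  y0 := M.y0
  y1 := M.y1
  left i := ¬ M.left i
  top := M.top
  Adj := M.Adj

/-- Reflection in the horizontal axis. -/
def ry (M : CM ι) : CM ι where
  C x y := M.C x (-y)
  sx := M.sx
  sy i := - M.sy i
  px := M.px
  py i := - M.py i
  x0 := M.x0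
  x1 := M.x1
  y0 i := - M.y1 i
  y1 i := - M.y0 i
  left := M.left
  top i := ¬ M.top i
  Adj := M.Adj

theorem rx_box (M : CM ι) (i x y) : M.rx.Box i x y ↔ M.Box i (-x) y := by
  simp only [Box, rx]; constructor <;> rintro ⟨a, b, c, d⟩ <;> refine ⟨?_, ?_, c, d⟩ <;> linarith

theorem ry_box (M : CM ι) (i x y) : M.ry.Box i x y ↔ M.Box i x (-y) := by
  simp only [Box, ry]; constructor <;> rintro ⟨a, b, c, d⟩ <;> refine ⟨a, b, ?_, ?_⟩ <;> linarith

theorem rx_lead (M : CM ι) (i x y) : M.rx.Lead i x y ↔ M.Lead i (-x) y := by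
  simp only [Lead, rx]
  constructor <;> rintro ⟨t, a, b, c, d⟩ <;> refine ⟨t, a, b, ?_, d⟩ <;> linarith

theorem ry_lead (M : CM ι) (i x y) : M.ry.Lead i x y ↔ M.Lead i x (-y) := by
  simp only [Lead, ry]
  constructor <;> rintro ⟨t, a, b, c, d⟩ <;> refine ⟨t, a, b, c, ?_⟩ <;> linarith

theorem rx_base (M : CM ι) (i x y) (h : M.rx.Base i x y) : M.Base i (-x) y := by
  simp only [Base, rx, not_not] at h
  obtain ⟨a, b, c, d⟩ := h
  exact ⟨fun h => by linarith [b h], fun h => by linarith [a h], c, d⟩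

theorem ry_base (M : CM ι) (i x y) (h : M.ry.Base i x y) : M.Base i x (-y) := by
  simp only [Base, ry, not_not] at h
  obtain ⟨a, b, c, d⟩ := h
  exact ⟨a, b, fun h => by linarith [d h], fun h => by linarith [c h]⟩

theorem rx_ahead (M : CM ι) (i x) : M.rx.Ahead i x ↔ M.Ahead i (-x) := by
  simp only [Ahead, rx, not_not]
  constructor <;> rintro ⟨a, b⟩ <;> exact ⟨fun h => by linarith [b h], fun h => by linarith [a h]⟩

theorem rx_t1 (M : CM ι) (i) : M.rx.t1 i = M.t1 i := by
  have : M.rx.BadUp i ↔ M.BadUp i := by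
    constructor
    · rintro ⟨x, y, a, b, c⟩; exact ⟨-x, y, a, (rx_ahead M i x).1 b, c⟩
    · rintro ⟨x, y, a, b, c⟩
      refine ⟨-x, y, ?_, (rx_ahead M i (-x)).2 (by simpa using b), c⟩
      simpa [rx] using a
  simp only [t1, this]; rfl

theorem rx_t0 (M : CM ι) (i) : M.rx.t0 i = M.t0 i := by
  have : M.rx.BadDown i ↔ M.BadDown i := by
    constructor
    · rintro ⟨x, y, a, b, c⟩; exact ⟨-x, y, a, (rx_ahead M i x).1 b, c⟩
    · rintro ⟨x, y, a, b, c⟩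
      refine ⟨-x, y, ?_, (rx_ahead M i (-x)).2 (by simpa using b), c⟩
      simpa [rx] using a
  simp only [t0, this]; rfl

theorem ry_bad (M : CM ι) (i) : M.ry.BadUp i ↔ M.BadDown i := by
  constructor
  · rintro ⟨x, y, a, b, c, d⟩
    refine ⟨x, -y, a, b, ?_, ?_⟩ <;> simp only [ry] at c d <;> linarith
  · rintro ⟨x, y, a, b, c, d⟩
    refine ⟨x, -y, ?_, b, ?_, ?_⟩
    · simpa [ry] using a
    all_goals simp only [ry]; linarith

theorem ry_bad' (M : CM ι) (i) : M.ry.BadDown i ↔ M.BadUp i := by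
  constructor
  · rintro ⟨x, y, a, b, c, d⟩
    refine ⟨x, -y, a, b, ?_, ?_⟩ <;> simp only [ry] at c d <;> linarith
  · rintro ⟨x, y, a, b, c, d⟩
    refine ⟨x, -y, ?_, b, ?_, ?_⟩
    · simpa [ry] using a
    all_goals simp only [ry]; linarith

theorem ry_t1 (M : CM ι) (i) : M.ry.t1 i = - M.t0 i := by
  simp only [t1, t0, ry_bad]; split_ifs <;> rfl

theorem ry_t0 (M : CM ι) (i) : M.ry.t0 i = - M.t1 i := by
  simp only [t1, t0, ry_bad']; split_ifs <;> rfl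

theorem OK.rx {M : CM ι} (h : M.OK) : M.rx.OK where
  conv x y x' y' t a b c d := by
    have := h.conv _ _ _ _ t a b c d
    show M.C _ _
    convert this using 1; ring
  Cs i := by simpa [CM.rx] using h.Cs i
  Cp i := by simpa [CM.rx] using h.Cp i
  star i j x y t a b c d e := by
    refine h.star i j (-x) y t a b c ?_ e
    simp only [CM.rx] at d; linarith
  chR i x a b := by
    have := h.chL i (-x) (by simpa [CM.rx] using a) b
    simp only [CM.rx]; linarith
  chL i x a b := by
    have := h.chR i (-x) (by simpa [CM.rx] using a) b
    simp only [CM.rx]; linarith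
  bx i := by have := h.bx i; simp only [CM.rx]; linarith
  byl := h.byl
  byh := h.byh
  pR i a := by
    have := h.pL i (by simpa [CM.rx] using a)
    simp only [CM.rx]; linarith
  pL i a := by
    have := h.pR i (by simpa [CM.rx] using a)
    simp only [CM.rx]; linarith
  bout i x y a b c d e := by
    simp only [CM.rx] at b c
    exact h.bout i (-x) y a (by linarith) (by linarith) d e
  hull i j k t a b c := by
    rw [rx_box] at c
    refine h.hull i j k t a b ?_
    simp only [CM.rx] at c
    convert c using 1; ring
  top1 := h.top1
  top2 := h.top2
  ld i j x y a b c := h.ld i j (-x) y a ((rx_lead M i x y).1 b) ((rx_lead M j x y).1 c)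
  ad i j x y a b c d := h.ad i j (-x) y a b ((rx_box M i x y).1 c) ((rx_box M j x y).1 d)
  adl i j x y a b c d := h.adl i j (-x) y a b ((rx_box M i x y).1 c) ((rx_lead M j x y).1 d)
  base i j x y a b c d := h.base i j (-x) y a b
    (c.imp (rx_box M j x y).1 (rx_lead M j x y).1) (rx_base M i x y d)
  sym := h.sym
  o1 u v a b c := by
    simp only [CM.rx] at a b c ⊢
    refine h.o1 u v (by tauto) b (fun w d => c w (by tauto))
  o4l b u a a' c d := by
    simp only [CM.rx, not_not] at a a' c d ⊢
    exact h.sym _ _ (h.o4l u b a' a d c)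
  o4h b u a a' c d := by
    simp only [CM.rx, not_not] at a a' c d ⊢
    exact h.sym _ _ (h.o4h u b a' a d c)
  o5 b c k d e f := by
    simp only [CM.rx] at e f ⊢
    obtain ⟨u, α, β, a1, a2, a3, a4, a5, a6, a7⟩ := h.o5 b c k d e (fun g => f (by linarith))
    exact ⟨u, α, β, a1, a2, a3, a4, a5, by linarith, a7⟩

theorem OK.ry {M : CM ι} (h : M.OK) : M.ry.OK where
  conv x y x' y' t a b c d := by
    have := h.conv _ _ _ _ t a b c d
    show M.C _ _
    convert this using 1; ring
  Cs i := by simpa [CM.ry] using h.Cs i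
  Cp i := by simpa [CM.ry] using h.Cp i
  star i j x y t a b c d e := by
    refine h.star i j x (-y) t a b c d ?_
    simp only [CM.ry] at e; linarith
  chR i x a b := h.chR i x a (by simpa [CM.ry] using b)
  chL i x a b := h.chL i x a (by simpa [CM.ry] using b)
  bx := h.bx
  byl i := by have := h.byh i; simp only [CM.ry]; linarith
  byh i := by have := h.byl i; simp only [CM.ry]; linarith
  pR := h.pR
  pL := h.pL
  bout i x y a b c d e := by
    simp only [CM.ry] at d e
    exact h.bout i x (-y) a b c (by linarith) (by linarith)
  hull i j k t a b c := by
    rw [ry_box] at c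
    refine h.hull i j k t a b ?_
    simp only [CM.ry] at c
    convert c using 1; ring
  top1 i a := by have := h.top2 i a; simp only [CM.ry]; linarith
  top2 i a := by have := h.top1 i (not_not.1 a); simp only [CM.ry]; linarith
  ld i j x y a b c := h.ld i j x (-y) a ((ry_lead M i x y).1 b) ((ry_lead M j x y).1 c)
  ad i j x y a b c d := h.ad i j x (-y) a b ((ry_box M i x y).1 c) ((ry_box M j x y).1 d)
  adl i j x y a b c d := h.adl i j x (-y) a b ((ry_box M i x y).1 c) ((ry_lead M j x y).1 d)
  base i j x y a b c d := h.base i j x (-y) a b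
    (c.imp (ry_box M j x y).1 (ry_lead M j x y).1) (ry_base M i x y d)
  sym := h.sym
  o1 u v a b c := by
    simp only [CM.ry] at a b c ⊢
    exact h.sym _ _ (h.o1 v u (by tauto) (by linarith)
      (fun w d e f => c w (by tauto) (by linarith) (by linarith)))
  o4l b u a a' c d := by
    simp only [CM.ry] at a a' c d ⊢
    exact h.o4h b u a a' (fun w e => by linarith [c w e]) (fun w e => by linarith [d w e])
  o4h b u a a' c d := by
    simp only [CM.ry] at a a' c d ⊢
    exact h.o4l b u a a' (fun w e => by linarith [c w e]) (fun w e => by linarith [d w e])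
  o5 b c k d e f := by
    simp only [CM.ry] at e f ⊢
    obtain ⟨u, α, β, a1, a2, a3, a4, a5, a6, a7⟩ := h.o5 b c k d e (fun g => f (by linarith))
    exact ⟨u, α, β, a1, a2, a3, a4, a5, a6, by linarith⟩


theorem solve2 (Px Py Zx Zy a b c d : ℝ) (hD : (Px - c) * (Zy - d) - (Py - d) * (Zx - c) ≠ 0) :
    ∃ α β, a = c + α * (Px - c) + β * (Zx - c) ∧ b = d + α * (Py - d) + β * (Zy - d) := by
  obtain ⟨D, eD⟩ : ∃ D, D = (Px - c) * (Zy - d) - (Py - d) * (Zx - c) := ⟨_, rfl⟩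
  rw [← eD] at hD
  refine ⟨((a - c) * (Zy - d) - (b - d) * (Zx - c)) / D,
    ((Px - c) * (b - d) - (Py - d) * (a - c)) / D, ?_, ?_⟩
  · field_simp; rw [eD]; ring
  · field_simp; rw [eD]; ring

theorem OK.block {M : CM ι} (h : M.OK) (k u : ι) (Px Py Zx Zy α β : ℝ)
    (cP : M.C Px Py) (cZ : M.C Zx Zy)
    (hD : (Px - M.sx k) * (Zy - M.sy k) - (Py - M.sy k) * (Zx - M.sx k) ≠ 0)
    (hα : 0 < α) (hβ : 0 < β)
    (ex : M.px u = M.sx k + α * (Px - M.sx k) + β * (Zx - M.sx k))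
    (ey : M.py u = M.sy k + α * (Py - M.sy k) + β * (Zy - M.sy k))
    (h1 : ∀ t, 0 ≤ t → t ≤ 1 → M.Lead u (Px + t * (Zx - Px)) (Py + t * (Zy - Py)) → False)
    (h2 : ∀ t r, 0 ≤ t → t ≤ 1 → 0 ≤ r → r ≤ 1 →
      Px + t * (Zx - Px) = M.sx k + r * (M.sx u - M.sx k) →
      Py + t * (Zy - Py) = M.sy k + r * (M.sy u - M.sy k) → False)
    (h3 : ∀ l, 1 < l → M.Lead u (M.sx k + l * (Zx - M.sx k)) (M.sy k + l * (Zy - M.sy k)) → False)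
    (h4 : ∀ l, 1 < l → M.Lead u (M.sx k + l * (Px - M.sx k)) (M.sy k + l * (Py - M.sy k)) → False) :
    False := by
  have hs : 0 < α + β := by linarith
  have s1 : 1 < α + β := by
    by_contra hle
    rcases (not_lt.1 hle).lt_or_eq with hlt | heq
    · refine h.star k u _ _ (α + β) (h.conv Px Py Zx Zy (β / (α + β)) cP cZ (by positivity)
        (by rw [div_le_one hs]; linarith)) hs.le hlt ?_ ?_
      · rw [ex]; field_simp; ring
      · rw [ey]; field_simp; ring
    · have : α = 1 - β := by linarith
      subst this
      refine h1 β hβ.le (by linarith) ⟨0, le_refl _, by norm_num, ?_, ?_⟩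
      · rw [ex]; ring
      · rw [ey]; ring
  obtain ⟨α', β', fx, fy⟩ : ∃ α' β', M.sx u = M.sx k + α' * (Px - M.sx k) + β' * (Zx - M.sx k) ∧
      M.sy u = M.sy k + α' * (Py - M.sy k) + β' * (Zy - M.sy k) :=
    solve2 _ _ _ _ _ _ _ _ hD
  by_cases hc : 0 ≤ α' ∧ 0 ≤ β' ∧ 1 ≤ α' + β'
  · obtain ⟨c1, c2, c3⟩ := hc
    have c4 : 0 < α' + β' := by linarith
    refine h2 (β' / (α' + β')) (1 / (α' + β')) (by positivity) (by rw [div_le_one c4]; linarith)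
      (by positivity) (by rw [div_le_one c4]; linarith) ?_ ?_
    · rw [fx]; field_simp; ring
    · rw [fy]; field_simp; ring
  · let f : ℝ → ℝ := fun τ => min (min (α + τ * (α' - α)) (β + τ * (β' - β)))
      (α + β - 1 + τ * (α' + β' - α - β))
    have hf : Continuous f := by fun_prop
    have f0 : 0 ≤ f 0 := by
      simp only [f, le_min_iff]; refine ⟨⟨?_, ?_⟩, ?_⟩ <;> linarith
    have f1 : f 1 ≤ 0 := by
      by_contra hn
      have := not_le.1 hn
      simp only [f, lt_min_iff] at this
      obtain ⟨⟨a, b⟩, c⟩ := this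
      exact hc ⟨by linarith, by linarith, by linarith⟩
    obtain ⟨τ, ⟨τ0, τ1⟩, hτ⟩ := intermediate_value_Icc' (zero_le_one' ℝ) hf.continuousOn
      (show (0:ℝ) ∈ Set.Icc (f 1) (f 0) from ⟨f1, f0⟩)
    have g : 0 ≤ f τ := hτ.ge
    simp only [f, le_min_iff] at g
    obtain ⟨⟨gA, gB⟩, gC⟩ := g
    obtain ⟨A, eA⟩ : ∃ A, A = α + τ * (α' - α) := ⟨_, rfl⟩
    obtain ⟨B, eB⟩ : ∃ B, B = β + τ * (β' - β) := ⟨_, rfl⟩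
    have lead : M.Lead u (M.sx k + A * (Px - M.sx k) + B * (Zx - M.sx k))
        (M.sy k + A * (Py - M.sy k) + B * (Zy - M.sy k)) := by
      refine ⟨τ, τ0, τ1, ?_, ?_⟩
      · rw [ex, fx, eA, eB]; ring
      · rw [ey, fy, eA, eB]; ring
    have hA : 0 ≤ A := by linarith
    have hB : 0 ≤ B := by linarith
    have hAB : 1 ≤ A + B := by linarith
    have key : A = 0 ∨ B = 0 ∨ A + B = 1 := by
      simp only [f] at hτ
      rcases min_choice (min (α + τ * (α' - α)) (β + τ * (β' - β)))
        (α + β - 1 + τ * (α' + β' - α - β)) with e | e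
      · rw [e] at hτ
        rcases min_choice (α + τ * (α' - α)) (β + τ * (β' - β)) with e | e
        · left; linarith
        · right; left; linarith
      · right; right; linarith
    clear_value f
    have k1 : A + B = 1 → False := by
      intro e
      have : A = 1 - B := by linarith
      subst this
      refine h1 B hB (by linarith) ?_
      convert lead using 1 <;> ring
    rcases key with e | e | e
    · rcases hAB.lt_or_eq with l | l
      · refine h3 B (by linarith) ?_
        convert lead using 1 <;> rw [e] <;> ring
      · exact k1 l.symm
    · rcases hAB.lt_or_eq with l | l
      · refine h4 A (by linarith) ?_
        convert lead using 1 <;> rw [e] <;> ring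
      · exact k1 l.symm
    · exact k1 e

theorem Box.seg {M : CM ι} {b : ι} {x y x' y' t : ℝ} (h : M.Box b x y) (h' : M.Box b x' y')
    (t0 : 0 ≤ t) (t1 : t ≤ 1) : M.Box b (x + t * (x' - x)) (y + t * (y' - y)) := by
  obtain ⟨a1, a2, a3, a4⟩ := h
  obtain ⟨b1, b2, b3, b4⟩ := h'
  refine ⟨?_, ?_, ?_, ?_⟩ <;> nlinarith

theorem OK.boxp {M : CM ι} (h : M.OK) (b : ι) : M.Box b (M.px b) (M.py b) := by
  refine ⟨?_, ?_, h.byl b, h.byh b⟩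
  · by_cases l : M.left b
    · rw [h.pL b l]; exact h.bx b
    · rw [h.pR b l]
  · by_cases l : M.left b
    · rw [h.pL b l]
    · rw [h.pR b l]; exact h.bx b

theorem leadp (M : CM ι) (b : ι) : M.Lead b (M.px b) (M.py b) :=
  ⟨0, le_refl _, zero_le_one, by ring, by ring⟩

theorem OK.leadC {M : CM ι} (h : M.OK) {b : ι} {x y : ℝ} (hl : M.Lead b x y) : M.C x y := by
  obtain ⟨t, a, b', rfl, rfl⟩ := hl
  exact h.conv _ _ _ _ t (h.Cp b) (h.Cs b) a b'

theorem OK.site {M : CM ι} (h : M.OK) {k b : ι} (hb : M.Box b (M.sx k) (M.sy k)) : False :=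
  h.hull k k b 0 (le_refl _) zero_le_one (by simpa using hb)

theorem OK.star' {M : CM ι} (h : M.OK) (k b : ι) (l : ℝ) (hl : 1 < l)
    (hc : M.C (M.sx k + l * (M.px b - M.sx k)) (M.sy k + l * (M.py b - M.sy k))) : False := by
  have : (0:ℝ) < l := by linarith
  refine h.star k b _ _ (1 / l) hc (by positivity) (by rw [div_lt_one this]; exact hl) ?_ ?_ <;>
  field_simp <;> ring

theorem coll0 (a b c d : ℝ) (h : a * d - b * c = 0) (hn : ¬ (c = 0 ∧ d = 0)) :
    ∃ k, a = k * c ∧ b = k * d := by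
  by_cases hc : c = 0
  · have hd : d ≠ 0 := fun e => hn ⟨hc, e⟩
    refine ⟨b / d, ?_, by field_simp⟩
    subst hc
    have : a * d = 0 := by linarith
    rcases mul_eq_zero.1 this with e | e
    · rw [e]; ring
    · exact absurd e hd
  · refine ⟨a / c, by field_simp, ?_⟩
    field_simp; linarith

theorem OK.coll {M : CM ι} (h : M.OK) (k b c : ι) (hbc : b ≠ c)
    (e : (M.px b - M.sx k) * (M.py c - M.sy k) - (M.py b - M.sy k) * (M.px c - M.sx k) = 0) :
    ∃ κ, κ ≤ 0 ∧ M.px b - M.sx k = κ * (M.px c - M.sx k) ∧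
      M.py b - M.sy k = κ * (M.py c - M.sy k) := by
  obtain ⟨κ, e1, e2⟩ := coll0 _ _ _ _ e (by
    rintro ⟨f, g⟩
    exact h.star k c _ _ 0 (h.Cs k) (le_refl _) zero_lt_one (by linarith) (by linarith))
  refine ⟨κ, ?_, e1, e2⟩
  by_contra hk
  have hk : 0 < κ := not_le.1 hk
  rcases lt_trichotomy κ 1 with l | l | l
  · exact h.star k b _ _ κ (h.Cp c) hk.le l (by linarith) (by linarith)
  · subst l
    refine h.ld b c _ _ hbc (leadp M b) ?_
    have e1 : M.px b = M.px c := by linarith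
    have e2 : M.py b = M.py c := by linarith
    rw [e1, e2]; exact leadp M c
  · refine h.star' k c κ l ?_
    have := h.Cp b
    rwa [show M.sx k + κ * (M.px c - M.sx k) = M.px b by linarith,
      show M.sy k + κ * (M.py c - M.sy k) = M.py b by linarith]

theorem OK.LB {M : CM ι} (h : M.OK) {b c : ι} (hbc : b ≠ c) {x y : ℝ} (hb : M.Box b x y)
    (hl : M.Lead c x y) : False := by
  by_cases hA : M.Adj b c
  · exact h.adl b c x y hA hbc hb hl
  obtain ⟨t, q0, q1, ex, ey⟩ := id hl
  obtain ⟨τ, eτ⟩ : ∃ τ, τ = 1 - t := ⟨_, rfl⟩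
  have et : t = 1 - τ := by linarith
  have ex' : x = M.sx c + τ * (M.px c - M.sx c) := by rw [ex, et]; ring
  have ey' : y = M.sy c + τ * (M.py c - M.sy c) := by rw [ey, et]; ring
  have τ0 : 0 < τ := by
    rcases (show 0 ≤ τ by linarith).lt_or_eq with l | l
    · exact l
    · exfalso
      rw [← l] at ex' ey'
      refine h.site (k := c) (b := b) ?_
      convert hb using 1
      · rw [ex']; ring
      · rw [ey']; ring
  by_cases hD : (M.px b - M.sx c) * (M.py c - M.sy c) - (M.py b - M.sy c) * (M.px c - M.sx c) = 0
  · obtain ⟨κ, k0, e1, e2⟩ := h.coll c b c hbc hD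
    have hp : 0 < τ - κ := by linarith
    refine h.site (k := c) (b := b) ?_
    have := Box.seg (h.boxp b) hb (t := -κ / (τ - κ)) (div_nonneg (by linarith) hp.le)
      (by rw [div_le_one hp]; linarith)
    have f1 : M.px b = M.sx c + κ * (M.px c - M.sx c) := by linarith
    have f2 : M.py b = M.sy c + κ * (M.py c - M.sy c) := by linarith
    convert this using 1
    · rw [f1, ex']; field_simp; ring
    · rw [f2, ey']; field_simp; ring
  · obtain ⟨u, α, β, a1, a2, a3, a4, a5, a6, a7⟩ := h.o5 b c c hbc hA hD
    refine h.block c u (M.px b) (M.py b) x y α (β / τ) (h.Cp b) (h.leadC hl) ?_ a4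
      (by positivity) ?_ ?_ ?_ ?_ ?_ ?_
    · rw [ex', ey']
      intro e
      apply hD
      have : τ * ((M.px b - M.sx c) * (M.py c - M.sy c) -
        (M.py b - M.sy c) * (M.px c - M.sx c)) = 0 := by linarith
      exact (mul_eq_zero.1 this).resolve_left τ0.ne'
    · rw [a6, ex']; field_simp; ring
    · rw [a7, ey']; field_simp; ring
    · intro r r0 r1 hr
      exact h.adl b u _ _ a1 a2.symm (Box.seg (h.boxp b) hb r0 r1) hr
    · intro r r' r0 r1 r2 r3 f1 f2
      refine h.hull c u b r' r2 r3 ?_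
      rw [← f1, ← f2]
      exact Box.seg (h.boxp b) hb r0 r1
    · intro l hl1 hl2
      have g1 : M.sx c + l * (x - M.sx c) = M.sx c + (l * τ) * (M.px c - M.sx c) := by
        rw [ex']; ring
      have g2 : M.sy c + l * (y - M.sy c) = M.sy c + (l * τ) * (M.py c - M.sy c) := by
        rw [ey']; ring
      rw [g1, g2] at hl2
      by_cases hlt : 1 < l * τ
      · exact h.star' c c _ hlt (h.leadC hl2)
      · refine h.ld u c _ _ a3 hl2 ⟨1 - l * τ, by linarith, ?_, by ring, by ring⟩
        have : 0 < l * τ := by positivity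
        linarith
    · intro l hl1 hl2
      exact h.star' c b _ hl1 (h.leadC hl2)

theorem OK.LC {M : CM ι} (h : M.OK) {b c : ι} (hbc : b ≠ c) (hA : ¬ M.Adj b c)
    (hb : ∀ t, 0 ≤ t → t ≤ 1 →
      M.Box b (M.px b + t * (M.px c - M.px b)) (M.py b + t * (M.py c - M.py b)) ∨
      M.Box c (M.px b + t * (M.px c - M.px b)) (M.py b + t * (M.py c - M.py b))) : False := by
  by_cases hD : (M.px b - M.sx b) * (M.py c - M.sy b) - (M.py b - M.sy b) * (M.px c - M.sx b) = 0
  · obtain ⟨κ, k0, e1, e2⟩ := h.coll b b c hbc hD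
    have hp : 0 < 1 - κ := by linarith
    have := hb (-κ / (1 - κ)) (div_nonneg (by linarith) hp.le)
      (by rw [div_le_one hp]; linarith)
    have f1 : M.px b = M.sx b + κ * (M.px c - M.sx b) := by linarith
    have f2 : M.py b = M.sy b + κ * (M.py c - M.sy b) := by linarith
    have g1 : M.px b + -κ / (1 - κ) * (M.px c - M.px b) = M.sx b := by
      rw [f1]; field_simp; ring
    have g2 : M.py b + -κ / (1 - κ) * (M.py c - M.py b) = M.sy b := by
      rw [f2]; field_simp; ring
    rw [g1, g2] at this
    rcases this with e | e <;> exact h.site e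
  · obtain ⟨u, α, β, a1, a2, a3, a4, a5, a6, a7⟩ := h.o5 b c b hbc hA hD
    refine h.block b u (M.px b) (M.py b) (M.px c) (M.py c) α β (h.Cp b) (h.Cp c) hD a4
      a5 a6 a7 ?_ ?_ ?_ ?_
    · intro r r0 r1 hr
      rcases hb r r0 r1 with e | e
      · exact h.LB a2.symm e hr
      · exact h.LB a3.symm e hr
    · intro r r' r0 r1 r2 r3 f1 f2
      have := hb r r0 r1
      rw [f1, f2] at this
      rcases this with e | e <;> exact h.hull _ _ _ _ r2 r3 e
    · intro l hl1 hl2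
      exact h.star' b c _ hl1 (h.leadC hl2)
    · intro l hl1 hl2
      exact h.star' b b _ hl1 (h.leadC hl2)

theorem ahead_r {M : CM ι} {b : ι} (hb : ¬ M.left b) {x : ℝ} : M.Ahead b x ↔ M.px b < x :=
  ⟨fun h => h.2 hb, fun h => ⟨fun e => absurd e hb, fun _ => h⟩⟩

theorem OK.py_t1 {M : CM ι} (h : M.OK) (b : ι) : M.py b ≤ M.t1 b := by
  unfold t1; split_ifs
  · exact le_refl _
  · exact h.byh b

theorem OK.t1_y1 {M : CM ι} (h : M.OK) (b : ι) : M.t1 b ≤ M.y1 b := by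
  unfold t1; split_ifs
  · exact h.byh b
  · exact le_refl _

theorem OK.t0_py {M : CM ι} (h : M.OK) (b : ι) : M.t0 b ≤ M.py b := by
  unfold t0; split_ifs
  · exact le_refl _
  · exact h.byl b

theorem OK.y0_t0 {M : CM ι} (h : M.OK) (b : ι) : M.y0 b ≤ M.t0 b := by
  unfold t0; split_ifs
  · exact h.byl b
  · exact le_refl _

theorem OK.thin {M : CM ι} (h : M.OK) {b : ι} (hb : ¬ M.left b) (hB : M.BadUp b) :
    M.x1 b = M.px b := by
  obtain ⟨x, y, hC, ha, h1, h2⟩ := hB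
  rw [ahead_r hb] at ha
  by_contra hne
  have e := h.pR b hb
  have d0 : 0 < M.x1 b - M.px b := by
    rcases (h.bx b).lt_or_eq with l | l
    · linarith
    · exact absurd (by linarith) hne
  have e0 : 0 < x - M.px b := by linarith
  obtain ⟨d, hd⟩ : ∃ d, d = M.x1 b - M.px b := ⟨_, rfl⟩
  obtain ⟨f, hf⟩ : ∃ f, f = x - M.px b := ⟨_, rfl⟩
  rw [← hd] at d0; rw [← hf] at e0
  have t0 : 0 < d / (d + f) := by positivity
  have t1 : d / (d + f) < 1 := by rw [div_lt_one (by positivity)]; linarith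
  have t2 : d / (d + f) * f < d := by
    rw [div_mul_eq_mul_div, div_lt_iff₀ (by positivity)]; nlinarith
  have t3 : 0 < d / (d + f) * f := by positivity
  have t4 : 0 < d / (d + f) * (y - M.py b) := mul_pos t0 (by linarith)
  have t5 : d / (d + f) * (y - M.py b) < y - M.py b := by nlinarith
  refine h.bout b _ _ (h.conv _ _ _ _ (d / (d + f)) (h.Cp b) hC t0.le t1.le) ?_ ?_ ?_ ?_
  · rw [← hf]; linarith
  · rw [← hf]; linarith
  · linarith [h.byl b]
  · linarith [h.byh b]

theorem OK.good {M : CM ι} (h : M.OK) {b : ι} (hb : ¬ M.left b) {x y : ℝ} (hC : M.C x y)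
    (h0 : M.t0 b ≤ y) (h1 : y ≤ M.t1 b) : x ≤ M.px b := by
  by_contra hn
  have hn : M.Ahead b x := (ahead_r hb).2 (not_le.1 hn)
  rcases lt_trichotomy y (M.py b) with l | l | l
  · by_cases hB : M.BadDown b
    · simp only [t0, hB, if_true] at h0; linarith
    · simp only [t0, hB, if_false] at h0
      exact hB ⟨x, y, hC, hn, l, h0⟩
  · rw [l] at hC
    have := h.chR b x hb hC
    linarith [(ahead_r hb).1 hn]
  · by_cases hB : M.BadUp b
    · simp only [t1, hB, if_true] at h1; linarith
    · simp only [t1, hB, if_false] at h1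
      exact hB ⟨x, y, hC, hn, l, h1⟩

/-- Two points of `C`, one below and one above height `y`: a point at that height. -/
theorem OK.cut {M : CM ι} (h : M.OK) {x y x' y' w : ℝ} (hC : M.C x y) (hC' : M.C x' y')
    (h1 : y ≤ w) (h2 : w ≤ y') (h3 : y < y') :
    M.C (x + (w - y) / (y' - y) * (x' - x)) w := by
  have := h.conv _ _ _ _ ((w - y) / (y' - y)) hC hC' (div_nonneg (by linarith) (by linarith))
    (by rw [div_le_one (by linarith)]; linarith)
  convert this using 1
  have : y' - y ≠ 0 := by linarith
  field_simp; ring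

theorem OK.low {M : CM ι} (h : M.OK) {b : ι} (hb : ¬ M.left b) (hB : M.BadUp b) {x y : ℝ}
    (hC : M.C x y) (hx : M.px b ≤ x) : M.py b ≤ y := by
  obtain ⟨x', y', hC', ha, h1, h2⟩ := hB
  rw [ahead_r hb] at ha
  by_contra hn
  have hn := not_le.1 hn
  have := h.chR b _ hb (h.cut hC hC' hn.le h1.le (by linarith))
  have p1 : 0 < (M.py b - y) / (y' - y) := div_pos (by linarith) (by linarith)
  have p2 : (M.py b - y) / (y' - y) < 1 := by
    rw [div_lt_one (by linarith)]; linarith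
  nlinarith

theorem OK.K {M : CM ι} (h : M.OK) {b j : ι} (hb : ¬ M.left b) (hB : M.BadUp b) (ht : M.top b)
    (hA : M.Adj b j) (hbj : b ≠ j) (hx : M.px b < M.px j) (hy : M.py j < M.y1 b) : False := by
  have thin := h.thin hb hB
  have e0 := h.pR b hb
  have inbox : ∀ y, M.C (M.px b) y → y ≤ M.y1 b → M.Box b (M.px b) y := fun y hC hy =>
    ⟨by linarith, by linarith, by linarith [h.low hb hB hC (le_refl _), h.byl b], hy⟩
  have hs : M.sx b < M.px b := by
    by_contra hn
    have hn := not_lt.1 hn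
    have l1 := h.low hb hB (h.Cs b) hn
    have l2 := h.top1 b ht
    have e : M.sy b = M.py b := by linarith
    have := h.chR b (M.sx b) hb (by rw [← e]; exact h.Cs b)
    have e' : M.sx b = M.px b := by linarith
    refine h.site (k := b) (b := b) ?_
    rw [e, e']; exact h.boxp b
  by_cases hq : M.px b < M.sx j ∧ M.sy j < M.y1 b
  · obtain ⟨q1, q2⟩ := hq
    have hd : 0 < M.sx j - M.sx b := by linarith
    have r0 : 0 ≤ (M.px b - M.sx b) / (M.sx j - M.sx b) := div_nonneg (by linarith) hd.le
    have r1 : (M.px b - M.sx b) / (M.sx j - M.sx b) ≤ 1 := by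
      rw [div_le_one hd]; linarith
    have cc := h.conv _ _ _ _ _ (h.Cs b) (h.Cs j) r0 r1
    refine h.hull b j b _ r0 r1 ?_
    have ee : M.sx b + (M.px b - M.sx b) / (M.sx j - M.sx b) * (M.sx j - M.sx b) = M.px b := by
      field_simp; ring
    rw [ee] at cc ⊢
    refine inbox _ cc ?_
    have := h.top1 b ht
    have := h.byh b
    nlinarith
  · let f : ℝ → ℝ := fun t => min (M.px j + t * (M.sx j - M.px j) - M.px b)
      (M.y1 b - (M.py j + t * (M.sy j - M.py j)))
    have hf : Continuous f := by fun_prop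
    have f0 : 0 ≤ f 0 := by
      simp only [f, le_min_iff]; constructor <;> linarith
    have f1 : f 1 ≤ 0 := by
      by_contra hn
      have := not_le.1 hn
      simp only [f, lt_min_iff] at this
      exact hq ⟨by linarith, by linarith⟩
    obtain ⟨τ, ⟨τ0, τ1⟩, hτ⟩ := intermediate_value_Icc' (zero_le_one' ℝ) hf.continuousOn
      (show (0:ℝ) ∈ Set.Icc (f 1) (f 0) from ⟨f1, f0⟩)
    have lead : M.Lead j (M.px j + τ * (M.sx j - M.px j)) (M.py j + τ * (M.sy j - M.py j)) :=
      ⟨τ, τ0, τ1, rfl, rfl⟩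
    have g : 0 ≤ f τ := hτ.ge
    simp only [f, le_min_iff] at g
    simp only [f] at hτ
    generalize M.px j + τ * (M.sx j - M.px j) = X at *
    generalize M.py j + τ * (M.sy j - M.py j) = Y at *
    rcases min_choice (X - M.px b) (M.y1 b - Y) with e | e
    · rw [e] at hτ
      have : X = M.px b := by linarith
      subst this
      exact h.adl b j _ _ hA hbj (inbox _ (h.leadC lead) (by linarith)) lead
    · rw [e] at hτ
      refine h.base b j _ _ hA hbj (Or.inr lead) ⟨fun l => absurd l hb, fun _ => by linarith,
        fun _ => by linarith, fun l => absurd ht l⟩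

theorem OK.K' {M : CM ι} (h : M.OK) {b j : ι} (hb : ¬ M.left b) (hB : M.BadDown b) (ht : ¬ M.top b)
    (hA : M.Adj b j) (hbj : b ≠ j) (hx : M.px b < M.px j) (hy : M.y0 b < M.py j) : False :=
  h.ry.K hb ((ry_bad M b).2 hB) ht hA hbj hx (by simp only [CM.ry]; linarith)

theorem OK.portbox {M : CM ι} (h : M.OK) {i j : ι} (hij : i ≠ j)
    (hb : M.Box j (M.px i) (M.py i)) : False :=
  h.LB hij.symm hb (leadp M i)

theorem OK.good' {M : CM ι} (h : M.OK) {i j : ι} (hj : ¬ M.left j) (hij : i ≠ j)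
    (h0 : M.t0 j ≤ M.py i) (h1 : M.py i ≤ M.t1 j) : M.px i < M.px j := by
  rcases (h.good hj (h.Cp i) h0 h1).lt_or_eq with l | l
  · exact l
  · exfalso
    refine h.portbox hij ?_
    rw [l]
    exact ⟨(h.boxp j).1, (h.boxp j).2.1, by linarith [h.y0_t0 j], by linarith [h.t1_y1 j]⟩

theorem OK.L2top {M : CM ι} (h : M.OK) {i j : ι} (hi : ¬ M.left i) (hj : ¬ M.left j)
    (hA : M.Adj i j) (hij : i ≠ j) (ht : M.top i) (h0 : M.t0 j ≤ M.t1 i) (h1 : M.t1 i ≤ M.t1 j)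
    (hx : M.x1 i ≤ M.x1 j) : False := by
  have a1 := h.y0_t0 j
  have a2 := h.t1_y1 j
  have a3 := h.bx j
  have a4 := h.pR j hj
  by_cases hB : M.BadUp i
  · have e : M.t1 i = M.py i := by simp only [t1, hB, if_true]
    rw [e] at h0 h1
    have l := h.good' hj hij h0 h1
    by_cases hy : M.py j < M.y1 i
    · exact h.K hi hB ht hA hij l hy
    · have b1 := h.thin hi hB
      have b2 := h.byh i
      have b3 := h.byh j
      exact h.base i j (M.px j) (M.y1 i) hA hij
        (Or.inl ⟨by linarith, by linarith, by linarith, by linarith⟩)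
        ⟨fun l => absurd l hi, fun _ => by linarith, fun _ => rfl, fun l => absurd ht l⟩
  · have e : M.t1 i = M.y1 i := by simp only [t1, hB, if_false]
    rw [e] at h0 h1
    exact h.base i j (M.x1 j) (M.y1 i) hA hij
        (Or.inl ⟨by linarith, by linarith, by linarith, by linarith⟩)
        ⟨fun l => absurd l hi, fun _ => by linarith, fun _ => rfl, fun l => absurd ht l⟩

theorem OK.L2bot {M : CM ι} (h : M.OK) {i j : ι} (hi : ¬ M.left i) (hj : ¬ M.left j)
    (hA : M.Adj i j) (hij : i ≠ j) (ht : ¬ M.top i) (h0 : M.t0 j ≤ M.t0 i) (h1 : M.t0 i ≤ M.t1 j)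
    (hx : M.x1 i ≤ M.x1 j) : False :=
  h.ry.L2top hi hj hA hij ht (by rw [ry_t0, ry_t1]; linarith) (by rw [ry_t1, ry_t1]; linarith) hx

def Rel (x X y l h : ℝ) (tp : Prop) (x' X' y' l' h' : ℝ) (tp' : Prop) : Prop :=
  y' < y ∧ h' < h ∧ l' < l ∧ x ≤ X ∧ x' ≤ X' ∧
    (h' < l ∨ (X < x' ∧ tp ∧ y' < l) ∨ (X' < x ∧ ¬ tp' ∧ h' < y))

theorem Rel.trans {x X y l h : ℝ} {tp : Prop} {x' X' y' l' h' : ℝ} {tp' : Prop}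
    {x'' X'' y'' l'' h'' : ℝ} {tp'' : Prop} (a : Rel x X y l h tp x' X' y' l' h' tp')
    (b : Rel x' X' y' l' h' tp' x'' X'' y'' l'' h'' tp'') :
    Rel x X y l h tp x'' X'' y'' l'' h'' tp'' := by
  obtain ⟨a1, a2, a3, a4, a5, a6⟩ := a
  obtain ⟨b1, b2, b3, b4, b5, b6⟩ := b
  refine ⟨by linarith, by linarith, by linarith, a4, b5, ?_⟩
  rcases a6 with a | ⟨a, c, d⟩ | ⟨a, c, d⟩
  · left; linarith
  · rcases b6 with e | ⟨e, f, g⟩ | ⟨e, f, g⟩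
    · left; linarith
    · right; left; exact ⟨by linarith, c, by linarith⟩
    · left; linarith
  · rcases b6 with e | ⟨e, f, g⟩ | ⟨e, f, g⟩
    · left; linarith
    · exact absurd f c
    · right; right; exact ⟨by linarith, f, by linarith⟩

def RR (M : CM ι) (i j : ι) : Prop :=
  Rel (M.px i) (M.x1 i) (M.py i) (M.t0 i) (M.t1 i) (M.top i)
    (M.px j) (M.x1 j) (M.py j) (M.t0 j) (M.t1 j) (M.top j)

theorem OK.L3 {M : CM ι} (h : M.OK) {i j : ι} (hi : ¬ M.left i) (hj : ¬ M.left j)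
    (hA : M.Adj i j) (hij : i ≠ j) (hy : M.py j < M.py i) : M.RR i j := by
  have a1 := h.y0_t0 j
  have a2 := h.t0_py j
  have a3 := h.py_t1 j
  have a4 := h.t1_y1 j
  have b1 := h.y0_t0 i
  have b2 := h.t0_py i
  have b3 := h.py_t1 i
  have b4 := h.t1_y1 i
  have c1 := h.pR i hi
  have c2 := h.pR j hj
  have d1 := h.bx i
  have d2 := h.bx j
  have g1 : M.py i ≤ M.t1 j → M.px i < M.px j := h.good' hj hij (by linarith)
  have g2 : M.t0 i ≤ M.py j → M.px j < M.px i := fun e => h.good' hi hij.symm e (by linarith)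
  have dis : M.t0 i ≤ M.t1 j → M.x1 i < M.px j ∨ M.x1 j < M.px i := by
    intro e
    by_contra hn
    push Not at hn
    obtain ⟨n1, n2⟩ := hn
    obtain ⟨m1, m2, m3, m4⟩ : M.t0 i ≤ max (M.t0 i) (M.t0 j) ∧ M.t0 j ≤ max (M.t0 i) (M.t0 j) ∧
      max (M.t0 i) (M.t0 j) ≤ M.t1 i ∧ max (M.t0 i) (M.t0 j) ≤ M.t1 j :=
      ⟨le_max_left _ _, le_max_right _ _, max_le (by linarith) (by linarith),
        max_le (by linarith) (by linarith)⟩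
    obtain ⟨k1, k2, k3, k4⟩ : M.px i ≤ max (M.px i) (M.px j) ∧ M.px j ≤ max (M.px i) (M.px j) ∧
      max (M.px i) (M.px j) ≤ M.x1 i ∧ max (M.px i) (M.px j) ≤ M.x1 j :=
      ⟨le_max_left _ _, le_max_right _ _, max_le (by linarith) (by linarith),
        max_le (by linarith) (by linarith)⟩
    exact h.ad i j (max (M.px i) (M.px j)) (max (M.t0 i) (M.t0 j)) hA hij
      ⟨by linarith, by linarith, by linarith, by linarith⟩
      ⟨by linarith, by linarith, by linarith, by linarith⟩
  have hA' := h.sym _ _ hA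
  have l1 : M.top i → M.t0 j ≤ M.t1 i → M.t1 i ≤ M.t1 j → M.x1 i ≤ M.x1 j → False :=
    h.L2top hi hj hA hij
  have l2 : M.top j → M.t0 i ≤ M.t1 j → M.t1 j ≤ M.t1 i → M.x1 j ≤ M.x1 i → False :=
    h.L2top hj hi hA' hij.symm
  have l3 : ¬ M.top i → M.t0 j ≤ M.t0 i → M.t0 i ≤ M.t1 j → M.x1 i ≤ M.x1 j → False :=
    h.L2bot hi hj hA hij
  have l4 : ¬ M.top j → M.t0 i ≤ M.t0 j → M.t0 j ≤ M.t1 i → M.x1 j ≤ M.x1 i → False :=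
    h.L2bot hj hi hA' hij.symm
  clear hA hA' h
  unfold RR Rel
  refine ⟨hy, ?_, ?_, by linarith, by linarith, ?_⟩
  · by_contra hn; grind
  · by_contra hn; grind
  · by_contra hn; grind

theorem OK.samey {M : CM ι} (h : M.OK) {i j : ι} (hi : ¬ M.left i) (hj : ¬ M.left j)
    (hij : i ≠ j) : M.py i ≠ M.py j := by
  intro e
  have a := h.chR i (M.px j) hi (by rw [e]; exact h.Cp j)
  have b := h.chR j (M.px i) hj (by rw [← e]; exact h.Cp i)
  have e' : M.px i = M.px j := le_antisymm b a
  refine h.ld i j _ _ hij (leadp M i) ?_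
  rw [e, e']; exact leadp M j

theorem OK.L4 [Fintype ι] {M : CM ι} (h : M.OK) : ∀ (n : ℕ) (i j : ι), ¬ M.left i → ¬ M.left j →
    M.py j < M.py i →
    (Finset.univ.filter (fun w => ¬ M.left w ∧ M.py j < M.py w ∧ M.py w < M.py i)).card = n →
    M.RR i j := by
  intro n
  induction n using Nat.strong_induction_on with
  | _ n ih =>
    intro i j hi hj hy hn
    by_cases hw : ∃ w, ¬ M.left w ∧ M.py j < M.py w ∧ M.py w < M.py i
    · obtain ⟨w, w1, w2, w3⟩ := hw
      have r1 := ih _ (by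
        rw [← hn]; apply Finset.card_lt_card
        rw [Finset.ssubset_iff_of_subset]
        · exact ⟨w, by simp [w1, w2, w3], by simp⟩
        · intro v; simp only [Finset.mem_filter, Finset.mem_univ, true_and]
          rintro ⟨a, b, c⟩; exact ⟨a, by linarith, c⟩) i w hi w1 w3 rfl
      have r2 := ih _ (by
        rw [← hn]; apply Finset.card_lt_card
        rw [Finset.ssubset_iff_of_subset]
        · exact ⟨w, by simp [w1, w2, w3], by simp⟩
        · intro v; simp only [Finset.mem_filter, Finset.mem_univ, true_and]
          rintro ⟨a, b, c⟩; exact ⟨a, b, by linarith⟩) w j w1 hj w2 rfl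
      exact Rel.trans r1 r2
    · refine h.L3 hi hj (h.o1 i j (by tauto) hy ?_) ?_ hy
      · intro w w1 w2 w3; exact hw ⟨w, by tauto, w2, w3⟩
      · rintro rfl; exact lt_irrefl _ hy

theorem OK.L4' [Fintype ι] {M : CM ι} (h : M.OK) {i j : ι} (hi : ¬ M.left i) (hj : ¬ M.left j)
    (hy : M.py j < M.py i) : M.RR i j := h.L4 _ i j hi hj hy rfl

theorem RR.dis {M : CM ι} {i j : ι} (h : M.RR i j) {x y : ℝ} (ei : M.px i = M.x0 i)
    (ej : M.px j = M.x0 j) (hi : M.Box i x y) (hj : M.Box j x y)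
    (i0 : M.t0 i ≤ y) (j1 : y ≤ M.t1 j) : False := by
  obtain ⟨a1, a2, a3, a4, a5, a6⟩ := h
  obtain ⟨b1, b2, b3, b4⟩ := hi
  obtain ⟨c1, c2, c3, c4⟩ := hj
  rcases a6 with a | ⟨a, -⟩ | ⟨a, -⟩ <;> linarith

theorem OK.same [Fintype ι] {M : CM ι} (h : M.OK) {i j : ι} (hi : ¬ M.left i) (hj : ¬ M.left j)
    (hij : i ≠ j) {x y : ℝ} (bi : M.Box i x y) (bj : M.Box j x y)
    (i0 : M.t0 i ≤ y) (i1 : y ≤ M.t1 i) (j0 : M.t0 j ≤ y) (j1 : y ≤ M.t1 j) : False := by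
  rcases lt_or_gt_of_ne (h.samey hi hj hij) with l | l
  · exact (h.L4' hj hi l).dis (h.pR j hj) (h.pR i hi) bj bi j0 i1
  · exact (h.L4' hi hj l).dis (h.pR i hi) (h.pR j hj) bi bj i0 j1

theorem OK.goodL {M : CM ι} (h : M.OK) {b : ι} (hb : M.left b) {x y : ℝ} (hC : M.C x y)
    (h0 : M.t0 b ≤ y) (h1 : y ≤ M.t1 b) : M.px b ≤ x := by
  have := h.rx.good (b := b) (not_not.2 hb) (x := -x) (y := y) (by simpa [CM.rx] using hC)
    (by rw [rx_t0]; exact h0) (by rw [rx_t1]; exact h1)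
  simp only [CM.rx] at this; linarith

theorem OK.L5 {M : CM ι} (h : M.OK) {a b : ι} (ha : M.left a) (hb : ¬ M.left b)
    (hA : ¬ M.Adj b a)
    (hab : a ≠ b) {x y : ℝ} (ba : M.Box a x y) (bb : M.Box b x y)
    (a0 : M.t0 a ≤ y) (a1 : y ≤ M.t1 a) (b0 : M.t0 b ≤ y) (b1 : y ≤ M.t1 b) : False := by
  have a2 := h.y0_t0 a
  have a3 := h.t0_py a
  have a4 := h.py_t1 a
  have a5 := h.t1_y1 a
  have b2 := h.y0_t0 b
  have b3 := h.t0_py b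
  have b4 := h.py_t1 b
  have b5 := h.t1_y1 b
  have ea := h.pL a ha
  have eb := h.pR b hb
  obtain ⟨u1, u2, u3, u4⟩ := ba
  obtain ⟨v1, v2, v3, v4⟩ := bb
  have pa : M.t0 b ≤ M.py a → M.py a ≤ M.t1 b → False := by
    intro c d
    have := h.good hb (h.Cp a) c d
    exact h.portbox hab ⟨by linarith, by linarith, by linarith, by linarith⟩
  have pb : M.t0 a ≤ M.py b → M.py b ≤ M.t1 a → False := by
    intro c d
    have := h.goodL ha (h.Cp b) c d
    exact h.portbox hab.symm ⟨by linarith, by linarith, by linarith, by linarith⟩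
  have fin : ∀ q, M.C q y → False := by
    intro q hq
    have g1 := h.good hb hq b0 b1
    have g2 := h.goodL ha hq a0 a1
    have e1 : M.px b = x := by linarith
    have e2 : M.px a = x := by linarith
    refine h.LC hab.symm hA ?_
    intro t t0 t1
    have q1 : M.px b + t * (M.px a - M.px b) = x := by rw [e1, e2]; ring
    rw [q1]
    rcases le_total (M.py b + t * (M.py a - M.py b)) y with l | l <;>
    rcases le_total (M.py a) y with l' | l'
    · by_cases r : M.py b ≤ y
      · rcases le_total (M.py a) (M.py b) with l'' | l''
        · exact (pb (by linarith) (by linarith)).elim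
        · exact (pa (by linarith) (by linarith)).elim
      · right; exact ⟨by linarith, by linarith, by nlinarith, by linarith⟩
    · left; exact ⟨by linarith, by linarith, by nlinarith, by linarith⟩
    · left; exact ⟨by linarith, by linarith, by linarith, by nlinarith⟩
    · by_cases r : M.py b ≤ y
      · right; exact ⟨by linarith, by linarith, by linarith, by nlinarith⟩
      · rcases le_total (M.py a) (M.py b) with l'' | l''
        · exact (pa (by linarith) (by linarith)).elim
        · exact (pb (by linarith) (by linarith)).elim
  rcases le_total (M.py a) y with l | l <;> rcases le_total (M.py b) y with l' | l'
  · rcases le_total (M.py a) (M.py b) with l'' | l''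
    · exact pb (by linarith) (by linarith)
    · exact pa (by linarith) (by linarith)
  · rcases (show M.py a ≤ M.py b by linarith).lt_or_eq with r | r
    · exact fin _ (h.cut (h.Cp a) (h.Cp b) l l' r)
    · exact pb (by linarith) (by linarith)
  · rcases (show M.py b ≤ M.py a by linarith).lt_or_eq with r | r
    · exact fin _ (h.cut (h.Cp b) (h.Cp a) l' l r)
    · exact pb (by linarith) (by linarith)
  · rcases le_total (M.py a) (M.py b) with l'' | l''
    · exact pa (by linarith) (by linarith)
    · exact pb (by linarith) (by linarith)

theorem OK.LM {M : CM ι} (h : M.OK) {u b : ι} (hu : ¬ M.left u) (hA : M.Adj u b) (hub : u ≠ b)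
    (e0 : M.x0 b = M.px b) (e1 : M.x1 b = M.px b) (hy : M.py b < M.py u) (hx : M.px u < M.px b) :
    Rel (M.px u) (M.x1 u) (M.py u) (M.t0 u) (M.t1 u) (M.top u)
      (M.px b) (M.px b) (M.py b) (M.py b) (M.y1 b) True := by
  have nB : ¬ M.BadUp u := fun hB => by
    have := h.low hu hB (h.Cp b) hx.le
    linarith
  have et : M.t1 u = M.y1 u := by simp only [t1, nB, if_false]
  have c1 := h.pR u hu
  have c2 := h.bx u
  have c3 := h.byl u
  have c4 := h.byh u
  have c5 := h.byl b
  have c6 := h.byh b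
  have c7 := h.y0_t0 u
  have c8 := h.t0_py u
  have k0 : M.py b < M.t0 u := by
    by_contra hn
    have := h.good hu (h.Cp b) (not_lt.1 hn) (by linarith [h.py_t1 u])
    linarith
  have bb : ∀ y, M.y0 b ≤ y → y ≤ M.y1 b → M.Box b (M.px b) y := fun y a c =>
    ⟨by linarith, by linarith, a, c⟩
  have key : M.y1 b < M.y1 u ∧ (M.y1 b < M.t0 u ∨ (M.x1 u < M.px b ∧ M.top u ∧ M.py b < M.t0 u)) := by
    by_cases ht : M.top u
    · have k1 : M.y1 b < M.y1 u := by
        by_contra hn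
        have hn := not_lt.1 hn
        by_cases hxx : M.x1 u ≤ M.px b
        · exact h.base u b _ _ hA hub (Or.inl (bb (M.y1 u) (by linarith) hn))
            ⟨fun l => absurd l hu, fun _ => hxx, fun _ => rfl, fun l => absurd ht l⟩
        · exact h.ad u b (M.px b) (M.y1 u) hA hub
            ⟨by linarith, by linarith, by linarith, by linarith⟩ (bb _ (by linarith) hn)
      refine ⟨k1, ?_⟩
      by_contra hn
      push Not at hn
      obtain ⟨n1, n2⟩ := hn
      have : M.px b ≤ M.x1 u := by
        by_contra l
        have := n2 (not_le.1 l) ht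
        linarith
      exact h.ad u b (M.px b) (M.y1 b) hA hub
            ⟨by linarith, by linarith, by linarith, by linarith⟩ (bb _ (by linarith) (le_refl _))
    · have k1 : M.y1 b < M.t0 u := by
        by_contra hn
        have hn := not_lt.1 hn
        have fin : M.y0 b ≤ M.y0 u → False := by
          intro l
          by_cases hxx : M.x1 u ≤ M.px b
          · exact h.base u b _ _ hA hub (Or.inl (bb (M.y0 u) (by linarith) (by linarith)))
              ⟨fun l => absurd l hu, fun _ => hxx, fun l => absurd l ht, fun _ => rfl⟩
          · exact h.ad u b (M.px b) (M.y0 u) hA hub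
              ⟨by linarith, by linarith, by linarith, by linarith⟩ (bb _ (by linarith) (by linarith))
        by_cases hB : M.BadDown u
        · by_cases hh : M.y0 u < M.py b
          · exact h.K' hu hB ht hA hub hx hh
          · exact fin (by linarith)
        · have : M.t0 u = M.y0 u := by simp only [t0, hB, if_false]
          exact fin (by linarith)
      exact ⟨by linarith, Or.inl k1⟩
  refine ⟨hy, by linarith [key.1], k0, by linarith, le_refl _, ?_⟩
  rcases key.2 with k | k
  · exact Or.inl k
  · exact Or.inr (Or.inl k)

theorem OK.side {M : CM ι} (h : M.OK) {b c w : ι} {v : ℝ} (hb : ∀ y, M.C v y → M.Box b v y)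
    (hc : M.px c < v) (hcb : c ≠ b) (hw : w ≠ b) : M.px w < v := by
  have gen : ∀ x x' : ℝ, x < v → v ≤ x' → ∃ t, 0 ≤ t ∧ t ≤ 1 ∧ x + t * (x' - x) = v := by
    intro x x' h1 h2
    have hd : 0 < x' - x := by linarith
    refine ⟨(v - x) / (x' - x), div_nonneg (by linarith) hd.le,
      by rw [div_le_one hd]; linarith, by field_simp; ring⟩
  have s1 : M.sx c < v := by
    by_contra hn
    obtain ⟨t, t0, t1, e⟩ := gen _ _ hc (not_lt.1 hn)
    have l : M.Lead c v (M.py c + t * (M.sy c - M.py c)) := ⟨t, t0, t1, e.symm, rfl⟩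
    exact h.LB hcb.symm (hb _ (h.leadC l)) l
  have s2 : M.sx w < v := by
    by_contra hn
    obtain ⟨t, t0, t1, e⟩ := gen _ _ s1 (not_lt.1 hn)
    have cc := h.conv _ _ _ _ t (h.Cs c) (h.Cs w) t0 t1
    refine h.hull c w b t t0 t1 ?_
    rw [e] at cc ⊢
    exact hb _ cc
  by_contra hn
  obtain ⟨t, t0, t1, e⟩ := gen _ _ s2 (not_lt.1 hn)
  have l : M.Lead w v (M.py w + (1 - t) * (M.sy w - M.py w)) :=
    ⟨1 - t, by linarith, by linarith, by rw [← e]; ring, rfl⟩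
  exact h.LB hw.symm (hb _ (h.leadC l)) l

theorem OK.thinR {M : CM ι} (h : M.OK) {b : ι} (hb : ¬ M.left b) {x y : ℝ} (bb : M.Box b x y)
    (hy : M.t1 b < y) : M.BadUp b ∧ x = M.px b := by
  have hB : M.BadUp b := by
    by_contra hB
    simp only [t1, hB, if_false] at hy
    linarith [bb.2.2.2]
  refine ⟨hB, ?_⟩
  have := h.thin hb hB
  linarith [bb.1, bb.2.1, h.pR b hb]

theorem OK.thinU {M : CM ι} (h : M.OK) {b : ι} {x y : ℝ} (bb : M.Box b x y)
    (hy : M.t1 b < y) : x = M.px b := by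
  by_cases hb : M.left b
  · have := (h.rx.thinR (b := b) (not_not.2 hb) (x := -x) (y := y)
      ((rx_box _ _ _ _).2 (by simpa using bb)) (by rw [rx_t1]; exact hy)).2
    simp only [CM.rx] at this; linarith
  · exact (h.thinR hb bb hy).2

theorem OK.thinD {M : CM ι} (h : M.OK) {b : ι} {x y : ℝ} (bb : M.Box b x y)
    (hy : y < M.t0 b) : x = M.px b :=
  h.ry.thinU (b := b) (x := x) (y := -y) ((ry_box _ _ _ _).2 (by simpa using bb))
    (by rw [ry_t1]; linarith)

theorem OK.L6R [Fintype ι] {M : CM ι} (h : M.OK) {b c : ι} (hb : ¬ M.left b) (hbc : b ≠ c)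
    (hA : ¬ M.Adj b c) {x y : ℝ} (bb : M.Box b x y) (bc : M.Box c x y) (hy : M.t1 b < y) :
    False := by
  obtain ⟨hB, ex⟩ := h.thinR hb bb hy
  have thin := h.thin hb hB
  have e0 := h.pR b hb
  have p1 := h.py_t1 b
  subst ex
  by_cases hx : M.px c = M.px b
  · refine h.LC hbc hA ?_
    intro t t0 t1
    obtain ⟨u1, u2, u3, u4⟩ := bb
    obtain ⟨v1, v2, v3, v4⟩ := bc
    have q1 : M.px b + t * (M.px c - M.px b) = M.px b := by rw [hx]; ring
    rw [q1]
    have b1 := h.byl b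
    have c1 := h.byl c
    have c2 := h.byh c
    rcases le_total (M.py b + t * (M.py c - M.py b)) y with l | l <;>
    rcases le_total (M.py c) (M.py b) with l' | l'
    · right; exact ⟨by linarith, by linarith, by nlinarith, by linarith⟩
    · left; exact ⟨by linarith, by linarith, by nlinarith, by linarith⟩
    · left; exact ⟨by linarith, by linarith, by nlinarith, by nlinarith⟩
    · right; exact ⟨by linarith, by linarith, by nlinarith, by nlinarith⟩
  have c0 : M.t0 c ≤ y := by
    by_contra l; exact hx (h.thinD bc (not_le.1 l)).symm
  have c1 : y ≤ M.t1 c := by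
    by_contra l; exact hx (h.thinU bc (not_le.1 l)).symm
  have G : ∀ Y, M.C (M.px b) Y → M.t0 c ≤ Y → Y ≤ M.t1 c → False := by
    intro Y hC l1 l2
    by_cases hc : M.left c
    · have := h.goodL hc hC l1 l2
      have := h.pL c hc
      exact hx (by linarith [bc.2.1])
    · have := h.good hc hC l1 l2
      have := h.pR c hc
      exact hx (by linarith [bc.1])
  have pbt : M.py b < M.t0 c := by
    by_contra l
    exact G _ (h.Cp b) (not_lt.1 l) (by linarith)
  have FC0 : ∀ Y, M.C (M.px b) Y → M.py b ≤ Y ∧ Y < M.t0 c := by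
    intro Y hC
    refine ⟨h.low hb hB hC (le_refl _), ?_⟩
    by_contra l
    have l := not_lt.1 l
    have := h.cut (h.Cp b) hC pbt.le l (by linarith)
    rw [sub_self, mul_zero, add_zero] at this
    exact G _ this (le_refl _) (by linarith)
  have FC : ∀ Y, M.C (M.px b) Y → M.Box b (M.px b) Y := by
    intro Y hC
    obtain ⟨l1, l2⟩ := FC0 Y hC
    exact ⟨by linarith, by linarith, by linarith [h.byl b], by linarith [bb.2.2.2]⟩
  by_cases hc : M.left c
  · have pc := h.pL c hc
    have hlt : M.px b < M.px c := lt_of_le_of_ne (by linarith [bc.2.1]) (Ne.symm hx)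
    have sd : ∀ w, w ≠ b → M.px b < M.px w := by
      intro w hw
      have := h.rx.side (b := b) (c := c) (w := w) (v := - M.px b)
        (fun Y hC => (rx_box _ _ _ _).2 (by
          simp only [CM.rx, neg_neg] at hC ⊢; exact FC Y hC))
        (by simp only [CM.rx]; linarith) hbc.symm hw
      simp only [CM.rx] at this; linarith
    obtain ⟨u, hu, umin⟩ := Finset.exists_min_image (Finset.univ.filter (fun w => M.left w)) M.py
      ⟨c, by simp [hc]⟩
    simp only [Finset.mem_filter, Finset.mem_univ, true_and] at hu umin
    have hub : u ≠ b := by rintro rfl; exact hb hu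
    have hAu : M.Adj b u := by
      refine h.o4l b u hb hu ?_ umin
      intro w hw
      by_cases e : w = b
      · rw [e]
      · exact h.low hb hB (h.Cp w) (sd w e).le
    have huc : u ≠ c := by rintro rfl; exact hA hAu
    have yu : M.py b < M.py u := by
      rcases (h.low hb hB (h.Cp u) (sd u hub).le).lt_or_eq with l | l
      · exact l
      · have := h.chR b (M.px u) hb (by rw [l]; exact h.Cp u)
        linarith [sd u hub]
    have yuc : M.py u < M.py c := lt_of_le_of_ne (umin c hc)
      (h.rx.samey (not_not.2 hu) (not_not.2 hc) huc)
    have r1 := h.rx.L4' (i := c) (j := u) (not_not.2 hc) (not_not.2 hu) yuc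
    have r2 := h.rx.LM (u := u) (b := b) (not_not.2 hu) (h.sym _ _ hAu) hub
      (by simp only [CM.rx]; linarith) (by simp only [CM.rx]; linarith) yu
      (by simp only [CM.rx]; linarith [sd u hub])
    obtain ⟨-, -, -, -, -, r⟩ := Rel.trans r1 r2
    rw [rx_t0] at r
    simp only [CM.rx, not_true, false_and, and_false, or_false] at r
    rcases r with r | ⟨r, -⟩
    · linarith [bb.2.2.2]
    · linarith [bc.1]
  · have pc := h.pR c hc
    have hlt : M.px c < M.px b := lt_of_le_of_ne (by linarith [bc.1]) hx
    have sd : ∀ w, w ≠ b → M.px w < M.px b := fun w hw => h.side FC hlt hbc.symm hw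
    obtain ⟨u, hu, umin⟩ := Finset.exists_min_image
      (Finset.univ.filter (fun w => ¬ M.left w ∧ M.py b < M.py w)) M.py
      ⟨c, by simp [hc]; linarith [h.t0_py c]⟩
    simp only [Finset.mem_filter, Finset.mem_univ, true_and] at hu umin
    have hub : u ≠ b := by rintro rfl; exact lt_irrefl _ hu.2
    have hAu : M.Adj u b := by
      refine h.o1 u b (by tauto) hu.2 ?_
      intro w w1 w2 w3
      have := umin w ⟨by tauto, w2⟩
      linarith
    have huc : u ≠ c := by rintro rfl; exact hA (h.sym _ _ hAu)
    have yuc : M.py u < M.py c := lt_of_le_of_ne (umin c ⟨hc, by linarith [h.t0_py c]⟩)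
      (h.samey hu.1 hc huc)
    have r1 := h.L4' (i := c) (j := u) hc hu.1 yuc
    have r2 := h.LM (u := u) (b := b) hu.1 hAu hub (by linarith) thin hu.2 (sd u hub)
    obtain ⟨-, -, -, -, -, r⟩ := Rel.trans r1 r2
    simp only [not_true, false_and, and_false, or_false] at r
    rcases r with r | ⟨r, -⟩
    · linarith [bb.2.2.2]
    · linarith [bc.2.1]

theorem OK.L6U [Fintype ι] {M : CM ι} (h : M.OK) {b c : ι} (hbc : b ≠ c)
    (hA : ¬ M.Adj b c) {x y : ℝ} (bb : M.Box b x y) (bc : M.Box c x y) (hy : M.t1 b < y) :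
    False := by
  by_cases hb : M.left b
  · exact h.rx.L6R (b := b) (c := c) (not_not.2 hb) hbc hA (x := -x) (y := y)
      ((rx_box _ _ _ _).2 (by simpa using bb)) ((rx_box _ _ _ _).2 (by simpa using bc))
      (by rw [rx_t1]; exact hy)
  · exact h.L6R hb hbc hA bb bc hy

theorem OK.L6 [Fintype ι] {M : CM ι} (h : M.OK) {b c : ι} (hbc : b ≠ c)
    (hA : ¬ M.Adj b c) {x y : ℝ} (bb : M.Box b x y) (bc : M.Box c x y) :
    M.t0 b ≤ y ∧ y ≤ M.t1 b := by
  constructor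
  · by_contra l
    exact h.ry.L6U (b := b) (c := c) hbc hA (x := x) (y := -y)
      ((ry_box _ _ _ _).2 (by simpa using bb)) ((ry_box _ _ _ _).2 (by simpa using bc))
      (by rw [ry_t1]; linarith [not_le.1 l])
  · by_contra l
    exact h.L6U hbc hA bb bc (not_le.1 l)

theorem OK.main [Fintype ι] {M : CM ι} (h : M.OK) {i j : ι} (hij : i ≠ j) {x y : ℝ}
    (hi : M.Box i x y ∨ M.Lead i x y) (hj : M.Box j x y ∨ M.Lead j x y) : False := by
  rcases hi with hi | hi <;> rcases hj with hj | hj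
  · by_cases hA : M.Adj i j
    · exact h.ad i j x y hA hij hi hj
    · have hA' : ¬ M.Adj j i := fun e => hA (h.sym _ _ e)
      obtain ⟨i0, i1⟩ := h.L6 hij hA hi hj
      obtain ⟨j0, j1⟩ := h.L6 hij.symm hA' hj hi
      by_cases li : M.left i <;> by_cases lj : M.left j
      · exact h.rx.same (i := i) (j := j) (not_not.2 li) (not_not.2 lj) hij (x := -x) (y := y)
          ((rx_box _ _ _ _).2 (by simpa using hi)) ((rx_box _ _ _ _).2 (by simpa using hj))
          (by rw [rx_t0]; exact i0) (by rw [rx_t1]; exact i1)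
          (by rw [rx_t0]; exact j0) (by rw [rx_t1]; exact j1)
      · exact h.L5 li lj hA' hij hi hj i0 i1 j0 j1
      · exact h.L5 lj li hA hij.symm hj hi j0 j1 i0 i1
      · exact h.same li lj hij hi hj i0 i1 j0 j1
  · exact h.LB hij hi hj
  · exact h.LB hij.symm hj hi
  · exact h.ld i j x y hij hi hj

def Up (x y : ℝ) : Prop := 0 < y ∨ (y = 0 ∧ 0 < x)

theorem three {a b a' b' c d : ℝ} (h1 : Up a b) (h2 : Up a' b') (h3 : Up (-c) (-d))
    (h : a * b' - b * a' < 0) : a' * d - b' * c < 0 ∨ c * b - d * a < 0 := by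
  by_contra hn
  push Not at hn
  obtain ⟨n1, n2⟩ := hn
  have id : b * (a' * d - b' * c) + b' * (c * b - d * a) + d * (a * b' - b * a') = 0 := by ring
  have hb : 0 ≤ b := by rcases h1 with l | ⟨l, -⟩ <;> linarith
  have hb' : 0 ≤ b' := by rcases h2 with l | ⟨l, -⟩ <;> linarith
  rcases h3 with l | ⟨l, l'⟩
  · nlinarith [mul_nonneg hb n1, mul_nonneg hb' n2]
  · have e : d = 0 := by linarith
    subst e
    rcases h1 with k | ⟨k, k'⟩
    · nlinarith
    · subst k
      rcases h2 with m | ⟨m, m'⟩ <;> nlinarith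

theorem ang {n : ℕ} (X Y : Fin n → ℝ) (R : Fin n → Prop)
    (ne : ∀ i, Up (X i) (Y i) ∨ Up (-X i) (-Y i))
    (hR : ∀ i j, i < j → R j → R i)
    (u1 : ∀ i j, i < j → Up (X i) (Y i) → Up (X j) (Y j) → R i → ¬ R j →
      X j * Y i - Y j * X i < 0)
    (u2 : ∀ i j, i < j → Up (X i) (Y i) → Up (X j) (Y j) → (R j ∨ ¬ R i) →
      X i * Y j - Y i * X j < 0)
    (dd : ∀ i j, i < j → Up (-X i) (-Y i) → Up (-X j) (-Y j) → X i * Y j - Y i * X j < 0)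
    (m1 : ∀ i j, i < j → R j → Up (X j) (Y j) → Up (-X i) (-Y i) → False)
    (m2 : ∀ i j, i < j → ¬ R i → Up (X i) (Y i) → Up (-X j) (-Y j) → False)
    (i j k : Fin n) (hij : i < j) (hjk : j < k) :
    (X i * Y j - Y i * X j < 0 ∧ X j * Y k - Y j * X k < 0) ∨
    (X j * Y k - Y j * X k < 0 ∧ X k * Y i - Y k * X i < 0) ∨
    (X k * Y i - Y k * X i < 0 ∧ X i * Y j - Y i * X j < 0) := by
  have hik := hij.trans hjk
  have T1 : ∀ a b c : Fin n, Up (X a) (Y a) → Up (X b) (Y b) → Up (-X c) (-Y c) →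
    X a * Y b - Y a * X b < 0 → X b * Y c - Y b * X c < 0 ∨ X c * Y a - Y c * X a < 0 :=
    fun a b c h1 h2 h3 h => three h1 h2 h3 h
  have T2 : ∀ a b c : Fin n, Up (-X a) (-Y a) → Up (-X b) (-Y b) → Up (X c) (Y c) →
    X a * Y b - Y a * X b < 0 → X b * Y c - Y b * X c < 0 ∨ X c * Y a - Y c * X a < 0 := by
    intro a b c h1 h2 h3 h
    have := three (c := - X c) (d := - Y c) h1 h2 (by simpa using h3) (by linarith)
    rcases this with l | l
    · left; linarith
    · right; linarith
  have r1 := hR i j hij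
  have r2 := hR j k hjk
  rcases ne i with a | a <;> rcases ne j with b | b <;> rcases ne k with c | c
  · by_cases rk : R k
    · exact Or.inl ⟨u2 i j hij a b (Or.inl (r2 rk)), u2 j k hjk b c (Or.inl rk)⟩
    · by_cases rj : R j
      · exact Or.inr (Or.inr ⟨u1 i k hik a c (r1 rj) rk, u2 i j hij a b (Or.inl rj)⟩)
      · by_cases ri : R i
        · exact Or.inr (Or.inl ⟨u2 j k hjk b c (Or.inr rj), u1 i k hik a c ri rk⟩)
        · exact Or.inl ⟨u2 i j hij a b (Or.inr ri), u2 j k hjk b c (Or.inr rj)⟩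
  · have q : R j ∨ ¬ R i := by
      by_contra q; push Not at q; exact m2 j k hjk q.1 b c
    have e := u2 i j hij a b q
    have := T1 i j k a b c e
    tauto
  · have q : R i ∧ ¬ R k := by
      constructor
      · by_contra q; exact m2 i j hij q a b
      · intro q; exact m1 j k hjk q c b
    have e := u1 i k hik a c q.1 q.2
    have := T1 k i j c a b e
    tauto
  · have e := dd j k hjk b c
    have := T2 j k i b c a e
    tauto
  · have q : ¬ R j := fun q => m1 i j hij q b a
    have e := u2 j k hjk b c (Or.inr q)
    have := T1 j k i b c a e
    tauto
  · by_cases rj : R j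
    · exact (m1 i j hij rj b a).elim
    · exact (m2 j k hjk rj b c).elim
  · have e := dd i j hij a b
    have := T2 i j k a b c e
    tauto
  · exact Or.inl ⟨dd i j hij a b, dd j k hjk b c⟩

structure Pre {n : ℕ} (M : CM (Fin n)) (R : Fin n → Prop) : Prop where
  conv : ∀ x y x' y' t : ℝ, M.C x y → M.C x' y' → 0 ≤ t → t ≤ 1 →
    M.C (x + t * (x' - x)) (y + t * (y' - y))
  Cs : ∀ i, M.C (M.sx i) (M.sy i)
  Cp : ∀ i, M.C (M.px i) (M.py i)
  star : ∀ i j x y t, M.C x y → 0 ≤ t → t < 1 →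
    M.px j = M.sx i + t * (x - M.sx i) → M.py j = M.sy i + t * (y - M.sy i) → False
  r1 : ∀ i x, R i → M.C x (M.py i) → x ≤ M.px i
  r2 : ∀ i x, ¬ R i → M.C x (M.py i) → M.px i ≤ x
  r3 : ∀ i, ¬ R i → ∃ x, M.C x (M.py i) ∧ M.px i < x
  rl : ∀ i, ¬ M.left i → R i
  cw : ∀ i j, i < j → (R i ∧ R j ∧ M.py j < M.py i) ∨ (R i ∧ ¬ R j) ∨
    (¬ R i ∧ ¬ R j ∧ M.py i < M.py j)
  chL : ∀ i x, M.left i → M.C x (M.py i) → M.px i ≤ x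
  wide : ∃ x x' y, M.C x y ∧ M.C x' y ∧ x < x'
  adj : ∀ i j, M.Adj i j ↔ (i.1 + 1) % n = j.1 ∨ (j.1 + 1) % n = i.1

section pre
variable {n : ℕ} {M : CM (Fin n)} {R : Fin n → Prop}

theorem Pre.sR (h : M.Pre R) (k : Fin n) {i j : Fin n} (hi : R i) (t : ℝ) (t0 : 0 ≤ t) (t1 : t < 1)
    (e : t * (M.py j - M.sy k) = M.py i - M.sy k) :
    t * (M.px j - M.sx k) < M.px i - M.sx k := by
  have hC := h.conv _ _ _ _ t (h.Cs k) (h.Cp j) t0 t1.le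
  have e' : M.sy k + t * (M.py j - M.sy k) = M.py i := by linarith
  have := h.r1 i _ hi (by rw [← e']; exact hC)
  rcases this.lt_or_eq with l | l
  · linarith
  · exact (h.star k i _ _ t (h.Cp j) t0 t1 l.symm e'.symm).elim

theorem Pre.sL (h : M.Pre R) (k : Fin n) {i j : Fin n} (hi : ¬ R i) (t : ℝ) (t0 : 0 ≤ t) (t1 : t < 1)
    (e : t * (M.py j - M.sy k) = M.py i - M.sy k) :
    M.px i - M.sx k < t * (M.px j - M.sx k) := by
  have hC := h.conv _ _ _ _ t (h.Cs k) (h.Cp j) t0 t1.le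
  have e' : M.sy k + t * (M.py j - M.sy k) = M.py i := by linarith
  have := h.r2 i _ hi (by rw [← e']; exact hC)
  rcases this.lt_or_eq with l | l
  · linarith
  · exact (h.star k i _ _ t (h.Cp j) t0 t1 l e'.symm).elim

theorem Pre.RL (h : M.Pre R) {i j : Fin n} (hi : R i) (hj : ¬ R j) (e : M.py i = M.py j) :
    M.px j < M.px i := by
  obtain ⟨x, a, b⟩ := h.r3 j hj
  rw [← e] at a
  linarith [h.r1 i x hi a]

theorem Pre.ang (h : M.Pre R) (k : Fin n) (i j l : Fin n) (hij : i < j) (hjl : j < l) :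
    let X := fun i => M.px i - M.sx k
    let Y := fun i => M.py i - M.sy k
    (X i * Y j - Y i * X j < 0 ∧ X j * Y l - Y j * X l < 0) ∨
    (X j * Y l - Y j * X l < 0 ∧ X l * Y i - Y l * X i < 0) ∨
    (X l * Y i - Y l * X i < 0 ∧ X i * Y j - Y i * X j < 0) := by
  intro X Y
  have n0 : ∀ i, ¬ (X i = 0 ∧ Y i = 0) := by
    rintro i ⟨a, b⟩
    simp only [X, Y] at a b
    exact h.star k i _ _ 0 (h.Cs k) (le_refl _) zero_lt_one (by linarith) (by linarith)
  have sR : ∀ i j t, R i → 0 ≤ t → t < 1 → t * Y j = Y i → t * X j < X i :=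
    fun i j t hi t0 t1 e => h.sR k hi t t0 t1 e
  have sL : ∀ i j t, ¬ R i → 0 ≤ t → t < 1 → t * Y j = Y i → X i < t * X j :=
    fun i j t hi t0 t1 e => h.sL k hi t t0 t1 e
  have RL : ∀ i j, R i → ¬ R j → Y i = Y j → X j < X i := by
    intro i j hi hj e
    have := h.RL hi hj (by simp only [Y] at e; linarith)
    simp only [X]; linarith
  have zR : ∀ i, R i → Y i = 0 → 0 < X i := by
    intro i hi e
    have := sR i i 0 hi (le_refl _) zero_lt_one (by rw [e]; ring)
    linarith
  have zL : ∀ i, ¬ R i → Y i = 0 → X i < 0 := by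
    intro i hi e
    have := sL i i 0 hi (le_refl _) zero_lt_one (by rw [e]; ring)
    linarith
  have cw : ∀ i j, i < j → (R i ∧ R j ∧ Y j < Y i) ∨ (R i ∧ ¬ R j) ∨ (¬ R i ∧ ¬ R j ∧ Y i < Y j) := by
    intro i j hij
    rcases h.cw i j hij with ⟨a, b, c⟩ | a | ⟨a, b, c⟩
    · left; exact ⟨a, b, by simp only [Y]; linarith⟩
    · right; left; exact a
    · right; right; exact ⟨a, b, by simp only [Y]; linarith⟩
  -- upper half, scaling `j` down to the height of `i`
  have pR : ∀ i j, R i → 0 < Y i → Y i < Y j → Y i * X j < X i * Y j := by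
    intro i j hi a b
    have c : 0 < Y j := by linarith
    have := sR i j (Y i / Y j) hi (by positivity) (by rw [div_lt_one c]; exact b) (by field_simp)
    rw [div_mul_eq_mul_div, div_lt_iff₀ c] at this; exact this
  have pL : ∀ i j, ¬ R i → 0 < Y i → Y i < Y j → X i * Y j < Y i * X j := by
    intro i j hi a b
    have c : 0 < Y j := by linarith
    have := sL i j (Y i / Y j) hi (by positivity) (by rw [div_lt_one c]; exact b) (by field_simp)
    rw [div_mul_eq_mul_div, lt_div_iff₀ c] at this; exact this
  have qR : ∀ i j, R i → Y i < 0 → Y j < Y i → X i * Y j < Y i * X j := by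
    intro i j hi a b
    have c : Y j < 0 := by linarith
    have := sR i j (Y i / Y j) hi (div_nonneg_of_nonpos a.le c.le) (by rw [div_lt_one_of_neg c]; exact b)
      (div_mul_cancel₀ _ c.ne)
    rw [div_mul_eq_mul_div, div_lt_iff_of_neg c] at this; exact this
  have qL : ∀ i j, ¬ R i → Y i < 0 → Y j < Y i → Y i * X j < X i * Y j := by
    intro i j hi a b
    have c : Y j < 0 := by linarith
    have := sL i j (Y i / Y j) hi (div_nonneg_of_nonpos a.le c.le) (by rw [div_lt_one_of_neg c]; exact b)
      (div_mul_cancel₀ _ c.ne)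
    rw [div_mul_eq_mul_div, lt_div_iff_of_neg c] at this; exact this
  clear_value X Y
  refine CM.ang X Y R ?_ ?_ ?_ ?_ ?_ ?_ ?_ i j l hij hjl
  · intro i
    rcases lt_trichotomy (Y i) 0 with a | a | a
    · right; left; linarith
    · rcases lt_trichotomy (X i) 0 with b | b | b
      · right; right; exact ⟨by linarith, by linarith⟩
      · exact (n0 i ⟨b, a⟩).elim
      · left; right; exact ⟨a, b⟩
    · left; left; exact a
  · intro i j hij hj
    rcases cw i j hij with a | a | a <;> tauto
  · intro i j _ a b hi hj
    have yj : 0 < Y j := by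
      rcases b with b | ⟨b, b'⟩
      · exact b
      · linarith [zL j hj b]
    rcases a with a | ⟨a, a'⟩
    · rcases lt_trichotomy (Y i) (Y j) with l | l | l
      · linarith [pR i j hi a l]
      · have := RL i j hi hj l
        rw [l]; nlinarith
      · linarith [pL j i hj yj l]
    · rw [a]; nlinarith
  · intro i j hij a b hh
    rcases cw i j hij with ⟨c1, c2, c3⟩ | ⟨c1, c2⟩ | ⟨c1, c2, c3⟩
    · rcases b with b | ⟨b, b'⟩
      · linarith [pR j i c2 b c3]
      · rw [b] at c3 ⊢; nlinarith
    · exfalso; tauto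
    · rcases a with a | ⟨a, a'⟩
      · linarith [pL i j c1 a c3]
      · linarith [zL i c1 a]
  · intro i j hij a b
    rcases cw i j hij with ⟨c1, c2, c3⟩ | ⟨c1, c2⟩ | ⟨c1, c2, c3⟩
    · rcases a with a | ⟨a, a'⟩
      · linarith [qR i j c1 (by linarith) c3]
      · linarith [zR i c1 (by linarith)]
    · have yi : Y i < 0 := by
        rcases a with a | ⟨a, a'⟩
        · linarith
        · linarith [zR i c1 (by linarith)]
      rcases b with b | ⟨b, b'⟩
      · have b : Y j < 0 := by linarith
        rcases lt_trichotomy (Y i) (Y j) with l | l | l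
        · linarith [qL j i c2 b l]
        · have := RL i j c1 c2 l
          rw [l]; nlinarith
        · linarith [qR i j c1 yi l]
      · have b : Y j = 0 := by linarith
        rw [b]; nlinarith
    · rcases b with b | ⟨b, b'⟩
      · linarith [qL j i c2 (by linarith) c3]
      · have b : Y j = 0 := by linarith
        rw [b] at c3 ⊢; nlinarith
  · intro i j hij hj b a
    have a' : Y i ≤ 0 := by rcases a with l | ⟨l, -⟩ <;> linarith
    have b' : 0 ≤ Y j := by rcases b with l | ⟨l, -⟩ <;> linarith
    rcases cw i j hij with ⟨c1, c2, c3⟩ | ⟨c1, c2⟩ | ⟨c1, c2, c3⟩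
    · linarith
    · tauto
    · tauto
  · intro i j hij hj b a
    have a' : Y j ≤ 0 := by rcases a with l | ⟨l, -⟩ <;> linarith
    have b' : 0 ≤ Y i := by rcases b with l | ⟨l, -⟩ <;> linarith
    rcases cw i j hij with ⟨c1, c2, c3⟩ | ⟨c1, c2⟩ | ⟨c1, c2, c3⟩
    · tauto
    · tauto
    · linarith

end pre

section pre
variable {n : ℕ} {M : CM (Fin n)} {R : Fin n → Prop}

theorem Pre.cut (h : M.Pre R) {x y x' y' w : ℝ} (hC : M.C x y) (hC' : M.C x' y')
    (h1 : y ≤ w) (h2 : w ≤ y') (h3 : y < y') :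
    M.C (x + (w - y) / (y' - y) * (x' - x)) w := by
  have := h.conv _ _ _ _ ((w - y) / (y' - y)) hC hC' (div_nonneg (by linarith) (by linarith))
    (by rw [div_le_one (by linarith)]; linarith)
  convert this using 1
  have : y' - y ≠ 0 := by linarith
  field_simp; ring

theorem Pre.tipx (h : M.Pre R) {i : Fin n} (li : M.left i) (ri : R i) {x : ℝ}
    (hC : M.C x (M.py i)) : x = M.px i :=
  le_antisymm (h.r1 i x ri hC) (h.chL i x li hC)

theorem Pre.tip (h : M.Pre R) {i : Fin n} (li : M.left i) (ri : R i) :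
    (∀ x y, M.C x y → y ≤ M.py i) ∨ (∀ x y, M.C x y → M.py i ≤ y) := by
  by_contra hn
  push Not at hn
  obtain ⟨⟨x1, y1, c1, l1⟩, ⟨x2, y2, c2, l2⟩⟩ := hn
  obtain ⟨a, a', y, ca, ca', haa⟩ := h.wide
  rcases lt_trichotomy y (M.py i) with l | l | l
  · have e1 := h.tipx li ri (h.cut ca c1 l.le l1.le (by linarith))
    have e2 := h.tipx li ri (h.cut ca' c1 l.le l1.le (by linarith))
    have t1 : (M.py i - y) / (y1 - y) < 1 := by
      rw [div_lt_one (by linarith)]; linarith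
    nlinarith
  · subst l
    linarith [h.tipx li ri ca, h.tipx li ri ca']
  · have e1 := h.tipx li ri (h.cut c2 ca l2.le l.le (by linarith))
    have e2 := h.tipx li ri (h.cut c2 ca' l2.le l.le (by linarith))
    have t1 : 0 < (M.py i - y2) / (y - y2) := div_pos (by linarith) (by linarith)
    nlinarith

theorem Pre.tipne (h : M.Pre R) {i w : Fin n} (li : M.left i) (ri : R i) (rw' : ¬ R w) :
    M.py w ≠ M.py i := by
  intro e
  obtain ⟨x, a, b⟩ := h.r3 w rw'
  rw [e] at a
  have := h.tipx li ri a
  have := h.tipx li ri (by rw [← e]; exact h.Cp w)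
  linarith

theorem Pre.adj_lt (h : M.Pre R) {u v : Fin n} (huv : u < v) (hw : ∀ w, u < w → w < v → False) :
    M.Adj u v := by
  rw [h.adj]; left
  have h1 : u.1 + 1 ≤ v.1 := huv
  have h2 : u.1 + 1 < n := lt_of_le_of_lt h1 v.2
  rw [Nat.mod_eq_of_lt h2]
  rcases h1.lt_or_eq with l | l
  · exact (hw ⟨u.1 + 1, h2⟩ (by simp [Fin.lt_def]) l).elim
  · exact l

theorem Pre.adj_wrap (h : M.Pre R) {u v : Fin n} (hu : ∀ w, w < u → False)
    (hv : ∀ w, v < w → False) : M.Adj u v := by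
  rw [h.adj]; right
  have hn : 0 < n := lt_of_le_of_lt (Nat.zero_le _) u.2
  have h1 : u.1 = 0 := by
    by_contra hne
    exact hu ⟨0, hn⟩ (Nat.pos_of_ne_zero hne)
  have h2 : v.1 + 1 = n := by
    by_contra hne
    have : v.1 + 1 < n := by have := v.2; omega
    exact hv ⟨v.1 + 1, this⟩ (by simp [Fin.lt_def])
  rw [h1, h2, Nat.mod_self]

theorem Pre.adjsym (h : M.Pre R) {u v : Fin n} (huv : M.Adj u v) : M.Adj v u := by
  rw [h.adj] at huv ⊢; exact huv.symm

theorem Pre.lr (h : M.Pre R) {i : Fin n} (hi : ¬ R i) : M.left i := by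
  by_contra l; exact hi (h.rl i l)

/-- a top tip is first -/
theorem Pre.topfirst (h : M.Pre R) {u : Fin n} (ru : R u) (ht : ∀ x y, M.C x y → y ≤ M.py u)
    (w : Fin n) (hw : w < u) : False := by
  rcases h.cw w u hw with ⟨a, b, c⟩ | ⟨a, b⟩ | ⟨a, b, c⟩
  · linarith [ht _ _ (h.Cp w)]
  · exact b ru
  · exact b ru

/-- a bottom tip is the last one on the right chain -/
theorem Pre.botlast (h : M.Pre R) {u : Fin n} (ht : ∀ x y, M.C x y → M.py u ≤ y)
    (w : Fin n) (hw : u < w) : ¬ R w := by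
  rcases h.cw u w hw with ⟨a, b, c⟩ | ⟨a, b⟩ | ⟨a, b, c⟩
  · linarith [ht _ _ (h.Cp w)]
  · exact b
  · exact b

theorem Pre.ltRR (h : M.Pre R) {u v : Fin n} (ru : R u) (rv : R v) (hy : M.py v < M.py u) :
    u < v := by
  rcases lt_trichotomy u v with l | l | l
  · exact l
  · rw [l] at hy; exact (lt_irrefl _ hy).elim
  · rcases h.cw v u l with ⟨a, b, c⟩ | ⟨a, b⟩ | ⟨a, b, c⟩
    · linarith
    · exact (b ru).elim
    · exact (a rv).elim

theorem Pre.ltRL (h : M.Pre R) {u v : Fin n} (ru : R u) (rv : ¬ R v) : u < v := by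
  rcases lt_trichotomy u v with l | l | l
  · exact l
  · rw [l] at ru; exact (rv ru).elim
  · rcases h.cw v u l with ⟨a, b, c⟩ | ⟨a, b⟩ | ⟨a, b, c⟩
    · exact (rv a).elim
    · exact (rv a).elim
    · exact (b ru).elim

theorem Pre.ltLL (h : M.Pre R) {u v : Fin n} (ru : ¬ R u) (rv : ¬ R v) (hy : M.py u < M.py v) :
    u < v := by
  rcases lt_trichotomy u v with l | l | l
  · exact l
  · rw [l] at hy; exact (lt_irrefl _ hy).elim
  · rcases h.cw v u l with ⟨a, b, c⟩ | ⟨a, b⟩ | ⟨a, b, c⟩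
    · exact (rv a).elim
    · exact (rv a).elim
    · linarith

theorem Pre.yRR (h : M.Pre R) {u v : Fin n} (huv : u < v) (rv : R v) :
    R u ∧ M.py v < M.py u := by
  rcases h.cw u v huv with ⟨a, b, c⟩ | ⟨a, b⟩ | ⟨a, b, c⟩ <;> tauto

theorem Pre.yLL (h : M.Pre R) {u v : Fin n} (huv : u < v) (ru : ¬ R u) :
    ¬ R v ∧ M.py u < M.py v := by
  rcases h.cw u v huv with ⟨a, b, c⟩ | ⟨a, b⟩ | ⟨a, b, c⟩ <;> tauto

theorem Pre.o1 (h : M.Pre R) (u v : Fin n) (hl : M.left u ↔ M.left v) (hy : M.py v < M.py u)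
    (hw : ∀ w, (M.left w ↔ M.left u) → M.py v < M.py w → M.py w < M.py u → False) :
    M.Adj u v := by
  by_cases lu : M.left u
  · have lv := hl.1 lu
    have hw : ∀ w, M.left w → M.py v < M.py w → M.py w < M.py u → False :=
      fun w a => hw w (by tauto)
    by_cases ru : R u <;> by_cases rv : R v
    · have tu : ∀ x y, M.C x y → y ≤ M.py u := (h.tip lu ru).resolve_right (fun e => by
        linarith [e _ _ (h.Cp v)])
      have tv : ∀ x y, M.C x y → M.py v ≤ y := (h.tip lv rv).resolve_left (fun e => by
        linarith [e _ _ (h.Cp u)])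
      refine h.adj_wrap (h.topfirst ru tu) ?_
      intro w w1
      have rw' := h.botlast tv w w1
      exact hw w (h.lr rw') (lt_of_le_of_ne (tv _ _ (h.Cp w)) (h.tipne lv rv rw').symm)
        (lt_of_le_of_ne (tu _ _ (h.Cp w)) (h.tipne lu ru rw'))
    · have tu : ∀ x y, M.C x y → y ≤ M.py u := (h.tip lu ru).resolve_right (fun e => by
        linarith [e _ _ (h.Cp v)])
      refine h.adj_wrap (h.topfirst ru tu) ?_
      intro w w1
      obtain ⟨rw', y'⟩ := h.yLL w1 rv
      exact hw w (h.lr rw') y' (lt_of_le_of_ne (tu _ _ (h.Cp w)) (h.tipne lu ru rw'))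
    · have tv : ∀ x y, M.C x y → M.py v ≤ y := (h.tip lv rv).resolve_left (fun e => by
        linarith [e _ _ (h.Cp u)])
      refine h.adjsym (h.adj_lt (h.ltRL rv ru) ?_)
      intro w w1 w2
      have rw' := h.botlast tv w w1
      exact hw w (h.lr rw') (lt_of_le_of_ne (tv _ _ (h.Cp w)) (h.tipne lv rv rw').symm)
        (h.yLL w2 rw').2
    · refine h.adjsym (h.adj_lt (h.ltLL rv ru hy) ?_)
      intro w w1 w2
      obtain ⟨rw', y'⟩ := h.yLL w1 rv
      exact hw w (h.lr rw') y' (h.yLL w2 rw').2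
  · have lv : ¬ M.left v := fun e => lu (hl.2 e)
    refine h.adj_lt (h.ltRR (h.rl _ lu) (h.rl _ lv) hy) ?_
    intro w w1 w2
    obtain ⟨rw', y'⟩ := h.yRR w2 (h.rl _ lv)
    obtain ⟨_, y''⟩ := h.yRR w1 rw'
    by_cases lw : M.left w
    · rcases h.tip lw rw' with e | e
      · linarith [e _ _ (h.Cp u)]
      · linarith [e _ _ (h.Cp v)]
    · exact hw w (by tauto) y' y''

theorem Pre.o4l (h : M.Pre R) (b u : Fin n) (lb : ¬ M.left b) (lu : M.left u)
    (hb : ∀ w, ¬ M.left w → M.py b ≤ M.py w) (hu : ∀ w, M.left w → M.py u ≤ M.py w) :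
    M.Adj b u := by
  have rb := h.rl b lb
  by_cases ru : R u
  · rcases h.tip lu ru with e | e
    · refine h.adjsym (h.adj_wrap (h.topfirst ru e) ?_)
      intro w w1
      by_cases rw' : R w
      · have y' := (h.yRR w1 rw').2
        by_cases lw : M.left w
        · linarith [hu w lw, e _ _ (h.Cp b)]
        · linarith [hb w lw]
      · exact h.tipne lu ru rw' (le_antisymm (e _ _ (h.Cp w)) (hu w (h.lr rw')))
    · have hy : M.py u < M.py b := by
        rcases (e _ _ (h.Cp b)).lt_or_eq with l | l
        · exact l
        · exfalso
          rcases lt_trichotomy u b with q | q | q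
          · linarith [(h.yRR q rb).2]
          · rw [q] at lu; exact lb lu
          · linarith [(h.yRR q ru).2]
      refine h.adj_lt (h.ltRR rb ru hy) ?_
      intro w w1 w2
      obtain ⟨rw', y'⟩ := h.yRR w2 ru
      obtain ⟨_, y''⟩ := h.yRR w1 rw'
      by_cases lw : M.left w
      · rcases h.tip lw rw' with q | q
        · linarith [q _ _ (h.Cp b)]
        · linarith [q _ _ (h.Cp u)]
      · linarith [hb w lw]
  · refine h.adj_lt (h.ltRL rb ru) ?_
    intro w w1 w2
    by_cases rw' : R w
    · have y' := (h.yRR w1 rw').2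
      by_cases lw : M.left w
      · rcases h.tip lw rw' with q | q
        · linarith [q _ _ (h.Cp b)]
        · exact h.tipne lw rw' ru (le_antisymm (hu w lw) (q _ _ (h.Cp u)))
      · linarith [hb w lw]
    · linarith [(h.yLL w2 rw').2, hu w (h.lr rw')]

theorem Pre.o4h (h : M.Pre R) (b u : Fin n) (lb : ¬ M.left b) (lu : M.left u)
    (hb : ∀ w, ¬ M.left w → M.py w ≤ M.py b) (hu : ∀ w, M.left w → M.py w ≤ M.py u) :
    M.Adj b u := by
  have rb := h.rl b lb
  by_cases ru : R u
  · rcases h.tip lu ru with e | e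
    · have hy : M.py b < M.py u := by
        rcases (e _ _ (h.Cp b)).lt_or_eq with l | l
        · exact l
        · exfalso
          rcases lt_trichotomy u b with q | q | q
          · linarith [(h.yRR q rb).2]
          · rw [q] at lu; exact lb lu
          · linarith [(h.yRR q ru).2]
      refine h.adjsym (h.adj_lt (h.ltRR ru rb hy) ?_)
      intro w w1 w2
      obtain ⟨rw', y'⟩ := h.yRR w2 rb
      obtain ⟨_, y''⟩ := h.yRR w1 rw'
      by_cases lw : M.left w
      · rcases h.tip lw rw' with q | q
        · linarith [q _ _ (h.Cp u)]
        · linarith [q _ _ (h.Cp b)]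
      · linarith [hb w lw]
    · refine h.adj_wrap ?_ ?_
      · intro w w1
        have y' := (h.yRR w1 rb).2
        by_cases lw : M.left w
        · linarith [hu w lw, e _ _ (h.Cp b)]
        · linarith [hb w lw]
      · intro w w1
        have rw' := h.botlast e w w1
        exact h.tipne lu ru rw' (le_antisymm (hu w (h.lr rw')) (e _ _ (h.Cp w)))
  · refine h.adj_wrap ?_ ?_
    · intro w w1
      obtain ⟨rw', y'⟩ := h.yRR w1 rb
      by_cases lw : M.left w
      · rcases h.tip lw rw' with q | q
        · exact h.tipne lw rw' ru (le_antisymm (q _ _ (h.Cp u)) (hu w lw))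
        · linarith [q _ _ (h.Cp b)]
      · linarith [hb w lw]
    · intro w w1
      obtain ⟨rw', y'⟩ := h.yLL w1 ru
      linarith [hu w (h.lr rw')]

theorem Pre.angc (h : M.Pre R) (k : Fin n) (i j l : Fin n)
    (hc : (i < j ∧ j < l) ∨ (j < l ∧ l < i) ∨ (l < i ∧ i < j))
    (hn : (M.px i - M.sx k) * (M.py l - M.sy k) - (M.py i - M.sy k) * (M.px l - M.sx k) < 0) :
    (M.px i - M.sx k) * (M.py j - M.sy k) - (M.py i - M.sy k) * (M.px j - M.sx k) < 0 ∧
    (M.px j - M.sx k) * (M.py l - M.sy k) - (M.py j - M.sy k) * (M.px l - M.sx k) < 0 := by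
  rcases hc with ⟨a, b⟩ | ⟨a, b⟩ | ⟨a, b⟩
  · rcases h.ang k _ _ _ a b with ⟨c, d⟩ | ⟨c, d⟩ | ⟨c, d⟩ <;> constructor <;> nlinarith
  · rcases h.ang k _ _ _ a b with ⟨c, d⟩ | ⟨c, d⟩ | ⟨c, d⟩ <;> constructor <;> nlinarith
  · rcases h.ang k _ _ _ a b with ⟨c, d⟩ | ⟨c, d⟩ | ⟨c, d⟩ <;> constructor <;> nlinarith

theorem Pre.o5 (h : M.Pre R) (b c k : Fin n) (hbc : b ≠ c) (hA : ¬ M.Adj b c)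
    (hD : (M.px b - M.sx k) * (M.py c - M.sy k) - (M.py b - M.sy k) * (M.px c - M.sx k) ≠ 0) :
    ∃ u α β, M.Adj b u ∧ u ≠ b ∧ u ≠ c ∧ 0 < α ∧ 0 < β ∧
      M.px u = M.sx k + α * (M.px b - M.sx k) + β * (M.px c - M.sx k) ∧
      M.py u = M.sy k + α * (M.py b - M.sy k) + β * (M.py c - M.sy k) := by
  have hb := b.2
  have hc := c.2
  have hbc' : b.1 ≠ c.1 := fun e => hbc (Fin.ext e)
  rw [h.adj] at hA
  push Not at hA
  obtain ⟨A1, A2⟩ := hA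
  have key : ∃ u : Fin n, M.Adj b u ∧ u ≠ b ∧ u ≠ c ∧
      0 < ((M.px u - M.sx k) * (M.py c - M.sy k) - (M.py u - M.sy k) * (M.px c - M.sx k)) /
      ((M.px b - M.sx k) * (M.py c - M.sy k) - (M.py b - M.sy k) * (M.px c - M.sx k)) ∧
      0 < ((M.px b - M.sx k) * (M.py u - M.sy k) - (M.py b - M.sy k) * (M.px u - M.sx k)) /
      ((M.px b - M.sx k) * (M.py c - M.sy k) - (M.py b - M.sy k) * (M.px c - M.sx k)) := by
    rcases lt_or_gt_of_ne hD with l | l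
    · have e : ∃ u : Fin n, (b.1 + 1) % n = u.1 ∧ (u.1 = b.1 + 1 ∨ (u.1 = 0 ∧ b.1 + 1 = n)) := by
        refine ⟨⟨(b.1 + 1) % n, Nat.mod_lt _ (by omega)⟩, rfl, ?_⟩
        simp only
        rcases (show b.1 + 1 < n ∨ b.1 + 1 = n by omega) with g | g
        · left; exact Nat.mod_eq_of_lt g
        · right; rw [g]; simp
      obtain ⟨u, e1, e2⟩ := e
      have uc : u.1 ≠ c.1 := by rw [← e1]; exact A1
      have := h.angc k b u c (by simp only [Fin.lt_def]; omega) l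
      refine ⟨u, (h.adj _ _).2 (Or.inl e1), ?_, fun e => uc (by rw [e]),
        div_pos_of_neg_of_neg this.2 l, div_pos_of_neg_of_neg this.1 l⟩
      intro e; rw [e] at e2; omega
    · have e : ∃ u : Fin n, (u.1 + 1) % n = b.1 ∧ (b.1 = u.1 + 1 ∨ (b.1 = 0 ∧ u.1 + 1 = n)) := by
        rcases Nat.eq_zero_or_pos b.1 with g | g
        · refine ⟨⟨n - 1, by omega⟩, ?_, ?_⟩
          · simp only; rw [show n - 1 + 1 = n by omega, g]; simp
          · simp only; omega
        · refine ⟨⟨b.1 - 1, by omega⟩, ?_, ?_⟩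
          · simp only; rw [show b.1 - 1 + 1 = b.1 by omega]; exact Nat.mod_eq_of_lt hb
          · simp only; omega
      obtain ⟨u, e1, e2⟩ := e
      have uc : u.1 ≠ c.1 := by intro e; rw [e] at e1; exact A2 e1
      have := h.angc k c u b (by simp only [Fin.lt_def]; omega) (by linarith)
      refine ⟨u, (h.adj _ _).2 (Or.inr e1), ?_, fun e => uc (by rw [e]),
        div_pos (by linarith [this.1]) l, div_pos (by linarith [this.2]) l⟩
      intro e; rw [e] at e2; omega
  obtain ⟨u, a1, a2, a3, a4, a5⟩ := key
  refine ⟨u, _, _, a1, a2, a3, a4, a5, ?_, ?_⟩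
  · generalize eD : (M.px b - M.sx k) * (M.py c - M.sy k) - (M.py b - M.sy k) * (M.px c - M.sx k) = D at *
    field_simp; rw [← eD]; ring
  · generalize eD : (M.px b - M.sx k) * (M.py c - M.sy k) - (M.py b - M.sy k) * (M.px c - M.sx k) = D at *
    field_simp; rw [← eD]; ring

end pre

end CM

/-- The coordinate model of a list of labels. -/
def mkCM (C : Set Pt) (L : List Label) : CM (Fin L.length) where
  C x y := ((x, y) : Pt) ∈ C
  sx i := (L[i]).site.1
  sy i := (L[i]).site.2
  px i := (L[i]).port.1
  py i := (L[i]).port.2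
  x0 i := (L[i]).lo.1
  x1 i := (L[i]).hi.1
  y0 i := (L[i]).lo.2
  y1 i := (L[i]).hi.2
  left i := (L[i]).isLeft = true
  top i := (L[i]).site.2 ≤ (L[i]).port.2
  Adj i j := (i.1 + 1) % L.length = j.1 ∨ (j.1 + 1) % L.length = i.1

theorem mk_box {C : Set Pt} {L : List Label} (i : Fin L.length) (x y : ℝ) :
    (mkCM C L).Box i x y ↔ ((x, y) : Pt) ∈ (L[i]).box := by
  simp only [CM.Box, mkCM, Label.box, Set.mem_Icc, Prod.le_def]
  tauto

theorem mk_lead {C : Set Pt} {L : List Label} (i : Fin L.length) (x y : ℝ) :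
    (mkCM C L).Lead i x y ↔ ((x, y) : Pt) ∈ (L[i]).leader := by
  simp only [CM.Lead, mkCM, Label.leader]
  rw [segment_symm, segment_eq_image']
  simp only [Set.mem_image, Set.mem_Icc, Prod.ext_iff, Prod.fst_add, Prod.snd_add, Prod.smul_fst,
    Prod.smul_snd, Prod.fst_sub, Prod.snd_sub, smul_eq_mul]
  constructor
  · rintro ⟨t, a, b, c, d⟩; exact ⟨t, ⟨a, b⟩, c.symm, d.symm⟩
  · rintro ⟨t, ⟨a, b⟩, c, d⟩; exact ⟨t, a, b, c.symm, d.symm⟩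

theorem mk_toSet {C : Set Pt} {L : List Label} (i : Fin L.length) (x y : ℝ) :
    ((mkCM C L).Box i x y ∨ (mkCM C L).Lead i x y) ↔ ((x, y) : Pt) ∈ (L[i]).toSet := by
  rw [mk_box, mk_lead]; rfl

theorem mk_base {C : Set Pt} {L : List Label} (i : Fin L.length) (x y : ℝ)
    (h : (mkCM C L).Base i x y) : ((x, y) : Pt) ∈ (L[i]).baseline := by
  obtain ⟨a, b, c, d⟩ := h
  simp only [mkCM] at a b c d
  unfold Label.baseline
  split_ifs with h1 h2 h2
  · exact ⟨c h2, a h1⟩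
  · exact ⟨d h2, a h1⟩
  · exact ⟨c h2, b h1⟩
  · exact ⟨d h2, b h1⟩

theorem mk_cons1 {L : List Label} (i j : Fin L.length) (h : (i.1 + 1) % L.length = j.1) :
    (L[i], L[j]) ∈ L.zip (L.rotate 1) := by
  rw [List.mem_iff_getElem]
  refine ⟨i.1, by simp, ?_⟩
  rw [List.getElem_zip, List.getElem_rotate]
  simp [h]

theorem mk_cons {C : Set Pt} {L : List Label} (i j : Fin L.length) (h : (mkCM C L).Adj i j) :
    Consecutive L L[i] L[j] :=
  h.imp (mk_cons1 i j) (mk_cons1 j i)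

theorem CwLT.trans' {C : Set Pt} {p q r : Pt} (h : CwLT C p q) (h' : CwLT C q r) : CwLT C p r := by
  unfold CwLT at *
  rcases h with ⟨a, b, c⟩ | ⟨a, b, c⟩ | ⟨a, b, c, d, e⟩ <;>
  rcases h' with ⟨a', b', c'⟩ | ⟨a', b', c'⟩ | ⟨a', b', c', d', e'⟩
  · exact Or.inl ⟨a, b', c'.trans c⟩
  · exact Or.inr (Or.inl ⟨a, b', c'⟩)
  · exact absurd b a'
  · exact absurd a' c
  · exact absurd a' c
  · exact Or.inr (Or.inl ⟨a, c', d'⟩)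
  · exact absurd a' d
  · exact absurd a' d
  · exact Or.inr (Or.inr ⟨a, b, c', d', e.trans e'⟩)

theorem mk_cw {C : Set Pt} {L : List Label} (h : InRadialOrder C L) (i j : Fin L.length)
    (hij : i < j) : CwLT C (L[i]).port (L[j]).port := by
  have : Trans (fun a b : Label => CwLT C a.port b.port) (fun a b : Label => CwLT C a.port b.port)
    (fun a b : Label => CwLT C a.port b.port) := ⟨fun h h' => h.trans' h'⟩
  have h2 : L.Pairwise (fun a b => CwLT C a.port b.port) := List.isChain_iff_pairwise.1 h
  exact List.pairwise_iff_getElem.1 h2 _ _ i.2 j.2 hij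

theorem mk_ne {L : List Label} (h : (L.map Label.site).Nodup) {i j : Fin L.length} (hij : i ≠ j) :
    L[i] ≠ L[j] := by
  intro e
  have h1 : L.Nodup := h.of_map
  exact hij (Fin.ext ((List.Nodup.getElem_inj_iff h1).1 e))

theorem mk_pre {C : Set Pt} {S : Finset Pt} {L : List Label} (hC : IsContour C)
    (hSin : ∀ s ∈ S, s ∈ interior C) (hlab : IsContourLabeling C S L)
    (hchains : PortsOnChains C L) :
    (mkCM C L).Pre (fun i => (L[i]).port ∈ rightChain C) := by
  have hm : ∀ i : Fin L.length, L[i] ∈ L := fun i => List.getElem_mem _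
  have hs : ∀ i : Fin L.length, (L[i]).site ∈ interior C := fun i =>
    hSin _ ((hlab.sites_iff _).2 (List.mem_map.2 ⟨_, hm i, rfl⟩))
  have hp : ∀ i : Fin L.length, (L[i]).port ∈ C := fun i =>
    (hlab.valid _ (hm i)).leader_in (right_mem_segment _ _ _)
  have hl : ∀ i : Fin L.length, (L[i]).port ∉ rightChain C → (L[i]).isLeft = true := by
    intro i h
    by_contra e
    exact h ((hchains _ (hm i)).2 (by simpa using e))
  refine ⟨?_, fun i => interior_subset (hs i), hp, ?_, ?_, ?_, ?_, ?_, ?_, ?_, ?_, fun _ _ => Iff.rfl⟩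
  · intro x y x' y' t a b c d
    have := hC.convex.add_smul_sub_mem a b ⟨c, d⟩
    exact this
  · intro i j x y t a b c d e
    have := hC.convex.combo_interior_self_mem_interior (hs i) a (a := 1 - t) (b := t) (by linarith) b
      (by ring)
    have e2 : (L[j]).port = (1 - t) • (L[i]).site + t • ((x, y) : Pt) := by
      simp only [mkCM] at d e
      ext
      · simp only [Prod.fst_add, Prod.smul_fst, smul_eq_mul]; rw [d]; ring
      · simp only [Prod.snd_add, Prod.smul_snd, smul_eq_mul]; rw [e]; ring
    rw [← e2] at this
    exact (hlab.valid _ (hm j)).port_bd.2 this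
  · intro i x a b
    exact a.2.2 _ b rfl
  · intro i x a b
    exact ((hchains _ (hm i)).1 (hl i a)).2.2 _ b rfl
  · intro i a
    by_contra hn
    push Not at hn
    refine a ⟨hp i, (hlab.valid _ (hm i)).port_bd, ?_⟩
    intro q hq e
    refine hn q.1 ?_
    show (q.1, (L[i]).port.2) ∈ C
    rw [← e]; exact hq
  · intro i a
    exact (hchains _ (hm i)).2 (by simpa [mkCM] using a)
  · intro i j hij
    have := mk_cw hlab.radial i j hij
    unfold CwLT at this
    simp only [mkCM]
    tauto
  · intro i x a b
    exact ((hchains _ (hm i)).1 a).2.2 _ b rfl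
  · obtain ⟨q, hq⟩ := hC.nonempty_interior
    have : Filter.Tendsto (fun s : ℝ => ((q.1 + s, q.2) : Pt)) (nhds 0) (nhds q) := by
      have h1 : Continuous (fun s : ℝ => ((q.1 + s, q.2) : Pt)) := by fun_prop
      have h2 := h1.tendsto 0
      simpa using h2
    have h3 := this.eventually (isOpen_interior.mem_nhds hq)
    obtain ⟨ε, e0, he⟩ := Metric.eventually_nhds_iff.1 h3
    refine ⟨q.1, q.1 + ε / 2, q.2, interior_subset hq, interior_subset (he ?_), by linarith⟩
    rw [Real.dist_eq, sub_zero, abs_of_pos] <;> linarith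

theorem mk_ok {C : Set Pt} {S : Finset Pt} {L : List Label} (hC : IsContour C)
    (hSin : ∀ s ∈ S, s ∈ interior C) (hlab : IsContourLabeling C S L)
    (hchains : PortsOnChains C L) (hstair : IsStaircase L) (hassum : Assumption1 S L)
    (hld : LeadersDisjoint L) (hcd : ConsecutiveDisjoint L) : (mkCM C L).OK := by
  have P := mk_pre hC hSin hlab hchains
  have hm : ∀ i : Fin L.length, L[i] ∈ L := fun i => List.getElem_mem _
  have hcd' : ∀ i j x y, (mkCM C L).Adj i j → i ≠ j →
      ((x, y) : Pt) ∈ (L[i]).toSet → ((x, y) : Pt) ∈ (L[j]).toSet → False := by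
    intro i j x y a b c d
    have := hcd _ _ (mk_cons i j a) (mk_ne hlab.nodup_sites b)
    exact (Set.ext_iff.1 this _).1 ⟨c, d⟩
  have hpy : ∀ i : Fin L.length, (L[i]).port.2 ∈ Set.Icc (L[i]).lo.2 (L[i]).hi.2 := by
    intro i
    cases e : (L[i]).isLeft
    · exact ((hlab.valid _ (hm i)).right_ok e).2
    · exact ((hlab.valid _ (hm i)).left_ok e).2
  have hld' : ∀ i j : Fin L.length, i < j → (L[i]).leader ∩ (L[j]).leader = ∅ := fun i j hij =>
    List.pairwise_iff_getElem.1 hld _ _ i.2 j.2 hij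
  exact {
    conv := P.conv
    Cs := P.Cs
    Cp := P.Cp
    star := P.star
    chR := fun i x a b => P.r1 i x (P.rl i a) b
    chL := P.chL
    bx := fun i => (hlab.valid _ (hm i)).lo_le_hi.1
    byl := fun i => (hpy i).1
    byh := fun i => (hpy i).2
    pR := fun i a => ((hlab.valid _ (hm i)).right_ok (by simpa [mkCM] using a)).1
    pL := fun i a => ((hlab.valid _ (hm i)).left_ok a).1
    bout := by
      intro i x y a b c d e
      have h1 := (hlab.valid _ (hm i)).box_out
      refine (Set.ext_iff.1 h1 ((x, y) : Pt)).1 ⟨?_, a⟩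
      unfold Label.box
      rw [← Prod.mk.eta (p := (L[i]).lo), ← Prod.mk.eta (p := (L[i]).hi), ← Set.Icc_prod_Icc,
        interior_prod_eq, interior_Icc, interior_Icc]
      exact ⟨⟨b, c⟩, ⟨d, e⟩⟩
    hull := by
      intro i j k t a b c
      rw [mk_box] at c
      refine (Set.ext_iff.1 (hassum _ (hm k)) _).1 ⟨c, ?_⟩
      have hs : ∀ i : Fin L.length, (L[i]).site ∈ convexHull ℝ (S : Set Pt) := fun i =>
        subset_convexHull _ _ ((hlab.sites_iff _).2 (List.mem_map.2 ⟨_, hm i, rfl⟩))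
      exact (convex_convexHull ℝ (S : Set Pt)).add_smul_sub_mem (hs i) (hs j) ⟨a, b⟩
    top1 := fun i a => a
    top2 := fun i a => (not_le.1 a).le
    ld := by
      intro i j x y a b c
      rw [mk_lead] at b c
      rcases lt_or_gt_of_ne a with l | l
      · exact (Set.ext_iff.1 (hld' i j l) _).1 ⟨b, c⟩
      · exact (Set.ext_iff.1 (hld' j i l) _).1 ⟨c, b⟩
    ad := fun i j x y a b c d => hcd' i j x y a b ((mk_toSet i x y).1 (Or.inl c))
      ((mk_toSet j x y).1 (Or.inl d))
    adl := fun i j x y a b c d => hcd' i j x y a b ((mk_toSet i x y).1 (Or.inl c))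
      ((mk_toSet j x y).1 (Or.inr d))
    base := by
      intro i j x y a b c d
      exact (Set.ext_iff.1 (hstair _ _ (mk_cons i j a)).2 ((x, y) : Pt)).1
        ⟨(mk_toSet j x y).1 c, mk_base i x y d⟩
    sym := fun i j a => P.adjsym a
    o1 := P.o1
    o4l := P.o4l
    o4h := P.o4h
    o5 := P.o5 }

/-- A staircase contour labeling satisfying Assumption 1, with
ports on the proper chains, is planar if and only if no two leaders intersect
and no two consecutive labels intersect. -/
theorem statement_5
    (C : Set Pt) (t : Pt) (S : Finset Pt) (L : List Label)
    (hC : IsContour C) (ht : IsTopmost C t)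
    (hSin : ∀ s ∈ S, s ∈ interior C) (hgen : GenPos S)
    (hlab : IsContourLabeling C S L)
    (hchains : PortsOnChains C L)
    (hstair : IsStaircase L)
    (hassum : Assumption1 S L) :
    PlanarList L ↔ (LeadersDisjoint L ∧ ConsecutiveDisjoint L) := by
  constructor
  · intro hp
    constructor
    · exact hp.imp (fun {a b} h => by
        rw [← Set.subset_empty_iff] at h ⊢
        exact (Set.inter_subset_inter Set.subset_union_right Set.subset_union_right).trans h)
    · intro a b hab hne
      have hsym : Std.Symm (fun a b : Label => a.toSet ∩ b.toSet = ∅) :=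
        ⟨fun a b h => by rw [Set.inter_comm]; exact h⟩
      have hmem : a ∈ L ∧ b ∈ L := by
        rcases hab with h | h
        · exact ⟨(List.of_mem_zip h).1, List.mem_rotate.1 (List.of_mem_zip h).2⟩
        · exact ⟨List.mem_rotate.1 (List.of_mem_zip h).2, (List.of_mem_zip h).1⟩
      exact hp.forall hmem.1 hmem.2 hne
  · rintro ⟨hld, hcd⟩
    have hok := mk_ok hC hSin hlab hchains hstair hassum hld hcd
    refine List.pairwise_iff_getElem.2 ?_
    intro i j hi hj hij
    rw [Set.eq_empty_iff_forall_notMem]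
    rintro ⟨x, y⟩ ⟨h1, h2⟩
    exact hok.main (i := ⟨i, hi⟩) (j := ⟨j, hj⟩) (fun e => hij.ne (Fin.ext_iff.1 e))
      ((mk_toSet (C := C) ⟨i, hi⟩ x y).2 h1) ((mk_toSet (C := C) ⟨j, hj⟩ x y).2 h2)
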